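/- Let k ≥ 2 be an integer, n > 2k, and let L ≥ 1. For i = 1,…,L let σᵢ ∈ [0,2k) and let fᵢ : ℝⁿ × ℝ^L → ℝ be continuous. Suppose u = (u₁,…,u_L) where each uᵢ is positive, of class C^{2k} on ℝⁿ∖{0} and continuous on ℝⁿ, and satisfies (−Δ)^k uᵢ(x) = |x|^{−σᵢ} fᵢ(x, u₁(x),…,u_L(x)) for all x ∈ ℝⁿ∖{0}, with fᵢ(x, u₁(x),…,u_L(x)) > 0 for all x. Assume moreover that there exist exponents p₁,…,p_L > 1, σ ∈ [0,2k) and a constant C > 0 such that Σ_{i=1}^L |x|^{−σᵢ} fᵢ(x, u₁(x),…,u_L(x)) ≥ C |x|^{−σ} Σ_{i=1}^L uᵢ(x)^{pᵢ} for all x ≠ 0. Then (−Δ)^j uᵢ(x) > 0 for all x ∈ ℝⁿ∖{0}, all i = 1,…,L and all j = 1,…,k−1. -/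

import Mathlib

open MeasureTheory

noncomputable section

/-- The Laplacian of `u : ℝⁿ → ℝ`: the sum of the pure second partial
derivatives along the coordinate directions. -/
def laplacian {n : ℕ} (u : EuclideanSpace ℝ (Fin n) → ℝ)
    (x : EuclideanSpace ℝ (Fin n)) : ℝ :=
  ∑ i : Fin n,
    iteratedFDeriv ℝ 2 u x ![EuclideanSpace.single i 1, EuclideanSpace.single i 1]

/-- `(-Δ)^j`, the j-th iterate of the negative Laplacian. -/
def negLapPow {n : ℕ} (j : ℕ) (u : EuclideanSpace ℝ (Fin n) → ℝ) :
    EuclideanSpace ℝ (Fin n) → ℝ :=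
  (fun v x => -laplacian v x)^[j] u

open scoped ContDiff Topology

/-- The `i`-th partial derivative. -/
def pderiv {n : ℕ} (i : Fin n) (f : EuclideanSpace ℝ (Fin n) → ℝ)
    (x : EuclideanSpace ℝ (Fin n)) : ℝ :=
  fderiv ℝ f x (EuclideanSpace.single i 1)

lemma two_le_smooth : (2 : WithTop ℕ∞) ≤ ∞ := WithTop.coe_le_coe.2 le_top

section Calculus

variable {n : ℕ} {f g w φ : EuclideanSpace ℝ (Fin n) → ℝ} {x : EuclideanSpace ℝ (Fin n)}

lemma laplacian_eq_sum_pderiv (hf : ContDiffAt ℝ 2 f x) :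
    laplacian f x = ∑ i, pderiv i (pderiv i f) x := by
  unfold laplacian pderiv
  refine Finset.sum_congr rfl fun i _ => ?_
  have h : DifferentiableAt ℝ (fderiv ℝ f) x :=
    (hf.fderiv_right (m := 1) (by norm_num)).differentiableAt (by norm_num)
  rw [iteratedFDeriv_two_apply, fderiv_clm_apply h (differentiableAt_const _)]
  simp

lemma ContDiffOn.pderiv {U : Set (EuclideanSpace ℝ (Fin n))} {m M : WithTop ℕ∞} (hU : IsOpen U)
    (hf : ContDiffOn ℝ M f U) (h : m + 1 ≤ M) (i : Fin n) :
    ContDiffOn ℝ m (pderiv i f) U :=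
  (hf.fderiv_of_isOpen hU h).clm_apply contDiffOn_const

lemma ContDiff.pderiv (hf : ContDiff ℝ ∞ f) (i : Fin n) : ContDiff ℝ ∞ (pderiv i f) := by
  rw [← contDiffOn_univ] at *
  exact hf.pderiv isOpen_univ (by simp) i

lemma ContDiffOn.laplacian {U : Set (EuclideanSpace ℝ (Fin n))} {m : WithTop ℕ∞} (hU : IsOpen U)
    (hf : ContDiffOn ℝ (m + 2) f U) : ContDiffOn ℝ m (laplacian f) U := by
  have h2 : m + 1 + 1 = m + 2 := by rw [add_assoc]; norm_num
  have h : ContDiffOn ℝ m (fun x => ∑ i, _root_.pderiv i (_root_.pderiv i f) x) U :=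
    ContDiffOn.sum fun i _ => (hf.pderiv hU h2.le i).pderiv hU le_rfl i
  refine h.congr fun x hx => laplacian_eq_sum_pderiv ?_
  exact (hf.contDiffAt (hU.mem_nhds hx)).of_le (by simp)

lemma negLapPow_succ (j : ℕ) (f : EuclideanSpace ℝ (Fin n) → ℝ) :
    negLapPow (j + 1) f = fun x => -laplacian (negLapPow j f) x :=
  Function.iterate_succ_apply' _ _ _

lemma negLapPow_add (i j : ℕ) (f : EuclideanSpace ℝ (Fin n) → ℝ) :
    negLapPow (i + j) f = negLapPow i (negLapPow j f) :=
  Function.iterate_add_apply _ _ _ _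

lemma ContDiff.negLapPow (hf : ContDiff ℝ ∞ f) (j : ℕ) : ContDiff ℝ ∞ (negLapPow j f) := by
  induction j with
  | zero => exact hf
  | succ j ih =>
    rw [negLapPow_succ]
    refine ContDiff.neg ?_
    rw [← contDiffOn_univ] at *
    exact ContDiffOn.laplacian isOpen_univ ih

lemma ContDiffOn.negLapPow {U : Set (EuclideanSpace ℝ (Fin n))} (hU : IsOpen U) (j : ℕ) {m : ℕ}
    (hf : ContDiffOn ℝ ((m + 2 * j : ℕ) : WithTop ℕ∞) f U) :
    ContDiffOn ℝ (m : WithTop ℕ∞) (negLapPow j f) U := by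
  induction j generalizing m with
  | zero => exact hf
  | succ j ih =>
    rw [negLapPow_succ]
    refine ContDiffOn.neg (ContDiffOn.laplacian hU ?_)
    have := @ih (m + 2) (by convert hf using 2; ring)
    exact_mod_cast this

lemma laplacian_congr (h : f =ᶠ[𝓝 x] g) : laplacian f x = laplacian g x := by
  unfold laplacian
  rw [(h.iteratedFDeriv ℝ 2).eq_of_nhds]

lemma negLapPow_congr (h : f =ᶠ[𝓝 x] g) (j : ℕ) : negLapPow j f =ᶠ[𝓝 x] negLapPow j g := by
  induction j with
  | zero => exact h
  | succ j ih =>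
    rw [negLapPow_succ, negLapPow_succ]
    filter_upwards [ih.eventuallyEq_nhds] with y hy
    rw [laplacian_congr hy]

lemma laplacian_const_mul (hf : ContDiff ℝ ∞ f) (c : ℝ) (x : EuclideanSpace ℝ (Fin n)) :
    laplacian (fun y => c * f y) x = c * laplacian f x := by
  unfold laplacian
  rw [Finset.mul_sum]
  refine Finset.sum_congr rfl fun i _ => ?_
  have := iteratedFDeriv_const_smul_apply' (i := 2) (x := x) (a := c)
    (hf.of_le two_le_smooth).contDiffAt
  simp only [smul_eq_mul] at this
  rw [this]
  simp

lemma laplacian_fun_sub (hf : ContDiff ℝ ∞ f) (hg : ContDiff ℝ ∞ g)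
    (x : EuclideanSpace ℝ (Fin n)) :
    laplacian (fun y => f y - g y) x = laplacian f x - laplacian g x := by
  have e := two_le_smooth
  have h1 : ∀ i, ContDiff ℝ 1 (pderiv i f) := fun i => (hf.pderiv i).of_le (by exact_mod_cast le_top)
  have h2 : ∀ i, ContDiff ℝ 1 (pderiv i g) := fun i => (hg.pderiv i).of_le (by exact_mod_cast le_top)
  rw [laplacian_eq_sum_pderiv ((hf.sub hg).of_le e).contDiffAt,
    laplacian_eq_sum_pderiv (hf.of_le e).contDiffAt,
    laplacian_eq_sum_pderiv (hg.of_le e).contDiffAt, ← Finset.sum_sub_distrib]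
  refine Finset.sum_congr rfl fun i _ => ?_
  have : pderiv i (fun y => f y - g y) = fun y => pderiv i f y - pderiv i g y := by
    funext y
    unfold pderiv
    rw [fderiv_fun_sub (hf.differentiable (by simp) y) (hg.differentiable (by simp) y)]
    rfl
  rw [this, pderiv, fderiv_fun_sub ((h1 i).differentiable (by simp) x)
    ((h2 i).differentiable (by simp) x)]
  rfl

lemma negLapPow_const_mul (hf : ContDiff ℝ ∞ f) (c : ℝ) (j : ℕ) :
    negLapPow j (fun y => c * f y) = fun y => c * negLapPow j f y := by
  induction j with
  | zero => rfl
  | succ j ih =>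
    rw [negLapPow_succ, negLapPow_succ, ih]
    funext x
    rw [laplacian_const_mul (hf.negLapPow j)]
    ring

lemma negLapPow_sub (hf : ContDiff ℝ ∞ f) (hg : ContDiff ℝ ∞ g) (j : ℕ) :
    negLapPow j (fun y => f y - g y) = fun y => negLapPow j f y - negLapPow j g y := by
  induction j with
  | zero => rfl
  | succ j ih =>
    rw [negLapPow_succ, negLapPow_succ, negLapPow_succ, ih]
    funext x
    rw [laplacian_fun_sub (hf.negLapPow j) (hg.negLapPow j)]
    ring

lemma laplacian_comp_affine (hf : ContDiff ℝ ∞ f) (c : ℝ) (a x : EuclideanSpace ℝ (Fin n)) :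
    laplacian (fun y => f (c • (y - a))) x = c ^ 2 * laplacian f (c • (x - a)) := by
  unfold laplacian
  rw [Finset.mul_sum]
  refine Finset.sum_congr rfl fun i _ => ?_
  have h1 := iteratedFDeriv_comp_const_smul (i := 2) c
    (hf.of_le two_le_smooth)
  have h2 := iteratedFDeriv_comp_sub (𝕜 := ℝ) (f := fun z => f (c • z)) 2 a x
  rw [h2, h1]
  simp

lemma negLapPow_comp_affine (hf : ContDiff ℝ ∞ f) (c : ℝ) (a : EuclideanSpace ℝ (Fin n)) (j : ℕ) :
    negLapPow j (fun y => f (c • (y - a))) =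
      fun y => c ^ (2 * j) * negLapPow j f (c • (y - a)) := by
  induction j with
  | zero => funext y; simp [negLapPow]
  | succ j ih =>
    rw [negLapPow_succ, negLapPow_succ, ih]
    funext x
    have h : ContDiff ℝ ∞ fun y => negLapPow j f (c • (y - a)) :=
      (hf.negLapPow j).comp ((contDiff_id.sub contDiff_const).const_smul c)
    rw [laplacian_const_mul h, laplacian_comp_affine (hf.negLapPow j)]
    ring

lemma negLapPow_comp_smul (hf : ContDiff ℝ ∞ f) (c : ℝ) (j : ℕ) :
    negLapPow j (fun y => f (c • y)) = fun y => c ^ (2 * j) * negLapPow j f (c • y) := by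
  simpa using negLapPow_comp_affine hf c 0 j

lemma tsupport_pderiv_subset (f : EuclideanSpace ℝ (Fin n) → ℝ) (i : Fin n) :
    tsupport (pderiv i f) ⊆ tsupport f :=
  tsupport_fderiv_apply_subset ℝ _

lemma negLapPow_eq_zero_of_notMem_tsupport (j : ℕ) (hx : x ∉ tsupport f) :
    negLapPow j f x = 0 := by
  have h := (negLapPow_congr (notMem_tsupport_iff_eventuallyEq.1 hx) j).eq_of_nhds
  rw [h]
  have : negLapPow j (0 : EuclideanSpace ℝ (Fin n) → ℝ) = fun _ => 0 := by
    have := negLapPow_const_mul (n := n) (f := fun _ => 0) contDiff_const 0 j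
    simpa [Pi.zero_def] using this
  rw [this]

lemma tsupport_negLapPow_subset (f : EuclideanSpace ℝ (Fin n) → ℝ) (j : ℕ) :
    tsupport (negLapPow j f) ⊆ tsupport f :=
  closure_minimal (fun _ hx => by_contra fun h => hx (negLapPow_eq_zero_of_notMem_tsupport j h))
    (isClosed_tsupport _)

lemma HasCompactSupport.negLapPow (hf : HasCompactSupport f) (j : ℕ) :
    HasCompactSupport (negLapPow j f) :=
  hf.of_isClosed_subset (isClosed_tsupport _) (tsupport_negLapPow_subset f j)

lemma integrable_mul_of_continuousOn {U : Set (EuclideanSpace ℝ (Fin n))} (hU : IsOpen U)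
    (hφ : Continuous φ) (hc : HasCompactSupport φ) (hs : tsupport φ ⊆ U) (hw : ContinuousOn w U) :
    Integrable (fun x => φ x * w x) := by
  refine Continuous.integrable_of_hasCompactSupport ?_ hc.mul_right
  refine ContinuousOn.continuous_of_tsupport_subset (hφ.continuousOn.mul hw) hU ?_
  exact (tsupport_mul_subset_left).trans hs

/-- Green's second identity for a test function supported in an open set `U`. -/
lemma integral_mul_laplacian {U : Set (EuclideanSpace ℝ (Fin n))} (hU : IsOpen U)
    (hφ : ContDiff ℝ ∞ φ) (hc : HasCompactSupport φ) (hs : tsupport φ ⊆ U)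
    (hw : ContDiffOn ℝ 2 w U) :
    ∫ x, φ x * laplacian w x = ∫ x, laplacian φ x * w x := by
  have hw1 : ∀ i, ContDiffOn ℝ 1 (pderiv i w) U := fun i => hw.pderiv hU (by norm_num) i
  have hw2 : ∀ i, ContinuousOn (pderiv i (pderiv i w)) U := fun i =>
    ((hw1 i).pderiv (m := 0) hU (by norm_num) i).continuousOn
  have hs1 : ∀ i, tsupport (pderiv i φ) ⊆ tsupport φ := tsupport_pderiv_subset φ
  have hs2 : ∀ i, tsupport (pderiv i (pderiv i φ)) ⊆ tsupport φ := fun i =>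
    (tsupport_pderiv_subset _ i).trans (hs1 i)
  have hc1 : ∀ i, HasCompactSupport (pderiv i φ) := fun i =>
    hc.of_isClosed_subset (isClosed_tsupport _) (hs1 i)
  have hc2 : ∀ i, HasCompactSupport (pderiv i (pderiv i φ)) := fun i =>
    hc.of_isClosed_subset (isClosed_tsupport _) (hs2 i)
  have hφ1 := fun i => hφ.pderiv i
  have hφ2 := fun i => (hφ1 i).pderiv i
  have i0 : ∀ i, Integrable (fun x => φ x * pderiv i (pderiv i w) x) := fun i =>
    integrable_mul_of_continuousOn hU hφ.continuous hc hs (hw2 i)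
  have i1 : ∀ i, Integrable (fun x => pderiv i φ x * pderiv i w x) := fun i =>
    integrable_mul_of_continuousOn hU (hφ1 i).continuous (hc1 i) ((hs1 i).trans hs)
      (hw1 i).continuousOn
  have i2 : ∀ i, Integrable (fun x => pderiv i (pderiv i φ) x * w x) := fun i =>
    integrable_mul_of_continuousOn hU (hφ2 i).continuous (hc2 i) ((hs2 i).trans hs)
      hw.continuousOn
  have dw : ∀ x ∈ U, DifferentiableAt ℝ w x := fun x hx =>
    (hw.contDiffAt (hU.mem_nhds hx)).differentiableAt (by norm_num)
  have dw1 : ∀ i, ∀ x ∈ U, DifferentiableAt ℝ (pderiv i w) x := fun i x hx =>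
    ((hw1 i).contDiffAt (hU.mem_nhds hx)).differentiableAt (by norm_num)
  calc ∫ x, φ x * laplacian w x = ∫ x, ∑ i, φ x * pderiv i (pderiv i w) x := by
        congr 1
        funext x
        by_cases hx : x ∈ tsupport φ
        · rw [laplacian_eq_sum_pderiv (hw.contDiffAt (hU.mem_nhds (hs hx))), Finset.mul_sum]
        · simp [image_eq_zero_of_notMem_tsupport hx]
    _ = ∑ i, ∫ x, φ x * pderiv i (pderiv i w) x := integral_finsetSum _ fun i _ => i0 i
    _ = ∑ i, ∫ x, pderiv i (pderiv i φ) x * w x := by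
        refine Finset.sum_congr rfl fun i _ => ?_
        have e1 := integral_mul_fderiv_eq_neg_fderiv_mul_of_integrable (μ := volume)
          (v := EuclideanSpace.single i (1 : ℝ)) (i1 i) (i0 i)
          (integrable_mul_of_continuousOn hU hφ.continuous hc hs (hw1 i).continuousOn)
          (fun x _ => hφ.differentiable (by simp) x) (fun x hx => dw1 i x (hs hx))
        have e2 := integral_mul_fderiv_eq_neg_fderiv_mul_of_integrable (μ := volume)
          (v := EuclideanSpace.single i (1 : ℝ)) (i2 i) (i1 i)
          (integrable_mul_of_continuousOn hU (hφ1 i).continuous (hc1 i) ((hs1 i).trans hs)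
            hw.continuousOn)
          (fun x _ => (hφ1 i).differentiable (by simp) x) (fun x hx => dw x (hs (hs1 i hx)))
        exact e1.trans (by rw [show (∫ x, fderiv ℝ φ x (EuclideanSpace.single i 1) * pderiv i w x) =
          -∫ x, pderiv i (pderiv i φ) x * w x from e2, neg_neg])
    _ = ∫ x, ∑ i, pderiv i (pderiv i φ) x * w x := (integral_finsetSum _ fun i _ => i2 i).symm
    _ = ∫ x, laplacian φ x * w x := by
        congr 1
        funext x
        rw [laplacian_eq_sum_pderiv (hφ.of_le two_le_smooth).contDiffAt,
          Finset.sum_mul]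

/-- Iterated integration by parts for a test function supported in an open set `U`. -/
lemma integral_mul_negLapPow {U : Set (EuclideanSpace ℝ (Fin n))} (hU : IsOpen U)
    (hφ : ContDiff ℝ ∞ φ) (hc : HasCompactSupport φ) (hs : tsupport φ ⊆ U) (j : ℕ)
    (hw : ContDiffOn ℝ ((2 * j : ℕ) : WithTop ℕ∞) w U) :
    ∫ x, φ x * negLapPow j w x = ∫ x, negLapPow j φ x * w x := by
  induction j generalizing φ with
  | zero => rfl
  | succ j ih =>
    have hw2 : ContDiffOn ℝ 2 (negLapPow j w) U := by
      have := ContDiffOn.negLapPow hU j (m := 2) (hw.of_le (by norm_cast; omega))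
      exact_mod_cast this
    have key := integral_mul_laplacian hU hφ hc hs hw2
    have h1 := ih (φ := negLapPow 1 φ) (hφ.negLapPow 1) (hc.negLapPow 1)
      ((tsupport_negLapPow_subset φ 1).trans hs) (hw.of_le (by norm_cast; omega))
    rw [← negLapPow_add] at h1
    rw [← h1, negLapPow_succ, show negLapPow 1 φ = fun x => -laplacian φ x from rfl]
    simp only [mul_neg, neg_mul, integral_neg, key]

end Calculus

section Cutoff

variable {n : ℕ} {f g w φ ψ θ u : EuclideanSpace ℝ (Fin n) → ℝ} {x : EuclideanSpace ℝ (Fin n)}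

lemma exists_param_pderiv {H : ℝ × EuclideanSpace ℝ (Fin n) → ℝ} (hH : ContDiff ℝ ∞ H)
    (i : Fin n) : ∃ H' : ℝ × EuclideanSpace ℝ (Fin n) → ℝ, ContDiff ℝ ∞ H' ∧
      ∀ ε, pderiv i (fun y => H (ε, y)) = fun y => H' (ε, y) := by
  refine ⟨fun q => fderiv ℝ H q (0, EuclideanSpace.single i 1),
    (hH.fderiv_right (by simp)).clm_apply contDiff_const, fun ε => ?_⟩
  funext y
  have h1 : HasFDerivAt H (fderiv ℝ H (ε, y)) (ε, y) :=
    (hH.differentiable (by simp) _).hasFDerivAt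
  have h2 := h1.comp y (hasFDerivAt_prodMk_right ε y)
  have h3 : fderiv ℝ (fun y => H (ε, y)) y = _ := h2.fderiv
  rw [pderiv, h3]
  simp

/-- Partial iterated Laplacians of a smooth function of a parameter are jointly smooth. -/
lemma exists_param_negLapPow {H : ℝ × EuclideanSpace ℝ (Fin n) → ℝ} (hH : ContDiff ℝ ∞ H)
    (j : ℕ) : ∃ H' : ℝ × EuclideanSpace ℝ (Fin n) → ℝ, ContDiff ℝ ∞ H' ∧
      ∀ ε, negLapPow j (fun y => H (ε, y)) = fun y => H' (ε, y) := by
  induction j with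
  | zero => exact ⟨H, hH, fun ε => rfl⟩
  | succ j ih =>
    obtain ⟨G, hG, hGe⟩ := ih
    choose A hA hAe using fun i => exists_param_pderiv hG i
    choose B hB hBe using fun i => exists_param_pderiv (hA i) i
    refine ⟨fun q => -∑ i, B i q, (ContDiff.sum fun i _ => hB i).neg, fun ε => ?_⟩
    rw [negLapPow_succ, hGe]
    funext y
    have hc : ContDiff ℝ ∞ fun y => G (ε, y) := hG.comp (contDiff_const.prodMk contDiff_id)
    rw [laplacian_eq_sum_pderiv (hc.of_le two_le_smooth).contDiffAt]
    congr 1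
    refine Finset.sum_congr rfl fun i _ => ?_
    rw [hAe i, hBe i]

/-- A smooth cutoff equal to `1` on the unit ball and to `0` outside the ball of radius `2`. -/
def cutoff (n : ℕ) (x : EuclideanSpace ℝ (Fin n)) : ℝ := Real.smoothTransition (2 - ‖x‖ ^ 2)

lemma contDiff_cutoff : ContDiff ℝ ∞ (cutoff n) :=
  Real.smoothTransition.contDiff.comp (contDiff_const.sub (contDiff_norm_sq ℝ))

lemma cutoff_nonneg (x : EuclideanSpace ℝ (Fin n)) : 0 ≤ cutoff n x :=
  Real.smoothTransition.nonneg _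

lemma cutoff_le_one (x : EuclideanSpace ℝ (Fin n)) : cutoff n x ≤ 1 :=
  Real.smoothTransition.le_one _

lemma cutoff_eq_one (hx : ‖x‖ ≤ 1) : cutoff n x = 1 :=
  Real.smoothTransition.one_of_one_le (by nlinarith [norm_nonneg x])

lemma cutoff_eq_zero (hx : 2 ≤ ‖x‖) : cutoff n x = 0 :=
  Real.smoothTransition.zero_of_nonpos (by nlinarith [norm_nonneg x])

lemma norm_inv_smul {ε : ℝ} (hε : 0 < ε) (x : EuclideanSpace ℝ (Fin n)) :
    ‖ε⁻¹ • x‖ = ‖x‖ / ε := by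
  rw [norm_smul, Real.norm_of_nonneg (inv_nonneg.2 hε.le), div_eq_inv_mul]

lemma tsupport_subset_closedBall {a : EuclideanSpace ℝ (Fin n)} {r : ℝ}
    (h : ∀ y, r < ‖y - a‖ → f y = 0) : tsupport f ⊆ Metric.closedBall a r :=
  closure_minimal (fun y hy => by
    by_contra hn
    exact hy (h y (by simpa [dist_eq_norm] using hn))) Metric.isClosed_closedBall

lemma hasCompactSupport_of_norm {a : EuclideanSpace ℝ (Fin n)} {r : ℝ}
    (h : ∀ y, r < ‖y - a‖ → f y = 0) : HasCompactSupport f :=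
  (isCompact_closedBall a r).of_isClosed_subset (isClosed_tsupport _)
    (tsupport_subset_closedBall h)

/-- Multiplying by a cutoff at scale `ε` costs `ε ^ (-2j)` after applying `(-Δ)^j`. -/
lemma exists_bound_negLapPow_mul_cutoff (hψ : ContDiff ℝ ∞ ψ) (j : ℕ) :
    ∃ C, 0 ≤ C ∧ ∀ ε, 0 < ε → ε ≤ 1 → ∀ x,
      |negLapPow j (fun y => ψ y * cutoff n (ε⁻¹ • y)) x| ≤ C * ε⁻¹ ^ (2 * j) := by
  obtain ⟨G, hG, hGe⟩ := exists_param_negLapPow (n := n)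
    (H := fun q => ψ (q.1 • q.2) * cutoff n q.2)
    ((hψ.comp (contDiff_fst.smul contDiff_snd)).mul (contDiff_cutoff.comp contDiff_snd)) j
  obtain ⟨C, hC⟩ := ((isCompact_Icc (a := (0 : ℝ)) (b := 1)).prod
    (isCompact_closedBall (0 : EuclideanSpace ℝ (Fin n)) 2)).exists_bound_of_continuousOn
    hG.continuous.continuousOn
  refine ⟨|C|, abs_nonneg _, fun ε hε hε1 x => ?_⟩
  have hs : ContDiff ℝ ∞ fun y => ψ (ε • y) * cutoff n y :=
    (hψ.comp (contDiff_id.const_smul ε)).mul contDiff_cutoff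
  have e : (fun y => ψ y * cutoff n (ε⁻¹ • y)) =
      fun y => (fun z => ψ (ε • z) * cutoff n z) (ε⁻¹ • y) := by
    funext y
    simp [smul_smul, hε.ne']
  rw [e, negLapPow_comp_smul hs, abs_mul, abs_of_nonneg (by positivity), mul_comm]
  refine mul_le_mul_of_nonneg_right ?_ (by positivity)
  by_cases hx : ‖ε⁻¹ • x‖ ≤ 2
  · have := hC (ε, ε⁻¹ • x) ⟨⟨hε.le, hε1⟩, by simpa using hx⟩
    have h2 := congrFun (hGe ε) (ε⁻¹ • x)
    simp only at h2
    rw [h2, ← Real.norm_eq_abs]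
    exact this.trans (le_abs_self C)
  · rw [negLapPow_eq_zero_of_notMem_tsupport]
    · simp
    · intro h
      refine hx ?_
      have := tsupport_subset_closedBall (a := 0) (r := 2)
        (fun y hy => by rw [cutoff_eq_zero (by simpa using hy.le), mul_zero]) h
      simpa using this

lemma volume_real_closedBall (a : EuclideanSpace ℝ (Fin n)) {r : ℝ} (hr : 0 ≤ r) :
    volume.real (Metric.closedBall a r) =
      r ^ n * volume.real (Metric.ball (0 : EuclideanSpace ℝ (Fin n)) 1) := by
  rw [Measure.addHaar_real_closedBall _ _ hr]
  simp

/-- If `u` is continuous and `(-Δ)^j u ≥ 0` holds classically away from the origin, with `2j < n`,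
then it holds in the sense of distributions on the whole space. -/
lemma integral_negLapPow_mul_nonneg {j : ℕ} (hj : 2 * j < n) (hu : Continuous u)
    (hus : ContDiffOn ℝ ((2 * j : ℕ) : WithTop ℕ∞) u {0}ᶜ)
    (hpos : ∀ x, x ≠ 0 → 0 ≤ negLapPow j u x) (hψ : ContDiff ℝ ∞ ψ) (hc : HasCompactSupport ψ)
    (h0 : ∀ x, 0 ≤ ψ x) : 0 ≤ ∫ x, negLapPow j ψ x * u x := by
  obtain ⟨C, hC0, hC⟩ := exists_bound_negLapPow_mul_cutoff hψ j
  obtain ⟨M, hM⟩ := (isCompact_closedBall (0 : EuclideanSpace ℝ (Fin n)) 2).exists_bound_of_continuousOn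
    hu.continuousOn
  set V := volume.real (Metric.ball (0 : EuclideanSpace ℝ (Fin n)) 1) with hV
  have hM0 : 0 ≤ M := (norm_nonneg _).trans (hM 0 (by simp))
  have key : ∀ ε : ℝ, 0 < ε → ε ≤ 1 →
      -(C * M * 2 ^ n * V) * ε ≤ ∫ x, negLapPow j ψ x * u x := by
    intro ε hε hε1
    have hs : ContDiff ℝ ∞ fun y => ψ y * cutoff n (ε⁻¹ • y) :=
      hψ.mul (contDiff_cutoff.comp (contDiff_id.const_smul _))
    have hsc : HasCompactSupport fun y => ψ y * cutoff n (ε⁻¹ • y) := hc.mul_right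
    have hz : ∀ y, 2 * ε < ‖y - 0‖ → ψ y * cutoff n (ε⁻¹ • y) = 0 := fun y hy => by
      rw [cutoff_eq_zero, mul_zero]
      rw [norm_inv_smul hε, le_div_iff₀ hε]
      simpa using hy.le
    have hsub : tsupport (fun y => ψ y - ψ y * cutoff n (ε⁻¹ • y)) ⊆ {0}ᶜ := by
      intro y hy h
      rw [Set.mem_singleton_iff] at h
      subst h
      refine notMem_tsupport_iff_eventuallyEq.2 ?_ hy
      filter_upwards [Metric.ball_mem_nhds (0 : EuclideanSpace ℝ (Fin n)) hε] with y hy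
      rw [cutoff_eq_one]
      · simp
      · rw [norm_inv_smul hε, div_le_one hε]
        simpa using (mem_ball_zero_iff.1 hy).le
    have h1 := integral_mul_negLapPow (φ := fun y => ψ y - ψ y * cutoff n (ε⁻¹ • y))
      isOpen_compl_singleton (hψ.sub hs) (hc.sub hsc) hsub j hus
    have h2 : 0 ≤ ∫ x, (ψ x - ψ x * cutoff n (ε⁻¹ • x)) * negLapPow j u x := by
      refine integral_nonneg fun x => ?_
      by_cases hx : x ∈ tsupport (fun y => ψ y - ψ y * cutoff n (ε⁻¹ • y))
      · refine mul_nonneg ?_ (hpos x (hsub hx))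
        nlinarith [h0 x, cutoff_le_one (ε⁻¹ • x), mul_nonneg (h0 x) (sub_nonneg.2 (cutoff_le_one (ε⁻¹ • x)))]
      · have := image_eq_zero_of_notMem_tsupport hx
        simp [this]
    rw [h1, negLapPow_sub hψ hs] at h2
    simp only [sub_mul] at h2
    rw [integral_sub] at h2
    rotate_left
    · exact integrable_mul_of_continuousOn isOpen_univ (hψ.negLapPow j).continuous (hc.negLapPow j)
        (Set.subset_univ _) hu.continuousOn
    · exact integrable_mul_of_continuousOn isOpen_univ (hs.negLapPow j).continuous (hsc.negLapPow j)
        (Set.subset_univ _) hu.continuousOn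
    have h3 : |∫ x, negLapPow j (fun y => ψ y * cutoff n (ε⁻¹ • y)) x * u x| ≤
        C * ε⁻¹ ^ (2 * j) * M * volume.real (Metric.closedBall (0 : EuclideanSpace ℝ (Fin n)) (2 * ε)) := by
      rw [← setIntegral_eq_integral_of_forall_compl_eq_zero
        (s := Metric.closedBall (0 : EuclideanSpace ℝ (Fin n)) (2 * ε))]
      · rw [← Real.norm_eq_abs]
        refine norm_setIntegral_le_of_norm_le_const (measure_closedBall_lt_top) fun x hx => ?_
        rw [norm_mul]
        have hx2 : x ∈ Metric.closedBall (0 : EuclideanSpace ℝ (Fin n)) 2 :=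
          Metric.closedBall_subset_closedBall (by linarith) hx
        exact mul_le_mul (hC ε hε hε1 x) (hM x hx2) (norm_nonneg _) (by positivity)
      · intro x hx
        rw [negLapPow_eq_zero_of_notMem_tsupport, zero_mul]
        exact fun h => hx (tsupport_subset_closedBall hz h)
    rw [volume_real_closedBall _ (by positivity), ← hV] at h3
    have h4 : C * ε⁻¹ ^ (2 * j) * M * ((2 * ε) ^ n * V) ≤ C * M * 2 ^ n * V * ε := by
      have : ε⁻¹ ^ (2 * j) * ε ^ n ≤ ε := by
        obtain ⟨d, rfl⟩ : ∃ d, n = 2 * j + (d + 1) := ⟨n - 2 * j - 1, by omega⟩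
        rw [pow_add, ← mul_assoc, ← mul_pow, inv_mul_cancel₀ hε.ne', one_pow, one_mul, pow_succ]
        exact mul_le_of_le_one_left hε.le (pow_le_one₀ hε.le hε1)
      have hV0 : 0 ≤ V := measureReal_nonneg
      calc _ = C * M * 2 ^ n * V * (ε⁻¹ ^ (2 * j) * ε ^ n) := by rw [mul_pow]; ring
        _ ≤ _ := by gcongr
    have h5 := (abs_le.1 h3).1
    linarith
  refine le_of_forall_pos_lt_add fun δ hδ => ?_
  set K := C * M * 2 ^ n * V with hK
  have hK0 : 0 ≤ K := by positivity
  have hd : 0 < min 1 (δ / (K + 1)) := by positivity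
  have h1 := key _ hd (min_le_left _ _)
  have h2 : K * min 1 (δ / (K + 1)) < δ := by
    calc K * min 1 (δ / (K + 1)) ≤ K * (δ / (K + 1)) := by gcongr; exact min_le_right _ _
      _ < δ := by
        rw [mul_div_assoc', div_lt_iff₀ (by positivity)]
        nlinarith
  linarith

end Cutoff

section Radial

variable {n : ℕ}

lemma hasFDerivAt_radial {h : ℝ → ℝ} (hh : ContDiff ℝ ∞ h) (x : EuclideanSpace ℝ (Fin n)) :
    HasFDerivAt (fun y : EuclideanSpace ℝ (Fin n) => h (‖y‖ ^ 2))
      (deriv h (‖x‖ ^ 2) • (2 • innerSL ℝ x)) x :=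
  ((hh.differentiable (by simp) _).hasDerivAt).comp_hasFDerivAt x
    (hasStrictFDerivAt_norm_sq x).hasFDerivAt

lemma pderiv_radial {h : ℝ → ℝ} (hh : ContDiff ℝ ∞ h) (i : Fin n) :
    pderiv i (fun y : EuclideanSpace ℝ (Fin n) => h (‖y‖ ^ 2)) =
      fun y => 2 * (y i * deriv h (‖y‖ ^ 2)) := by
  funext x
  rw [pderiv, (hasFDerivAt_radial hh x).fderiv]
  simp [EuclideanSpace.inner_single_right]
  ring

/-- The Laplacian of a radial function `h (|x| ^ 2)`. -/
lemma laplacian_radial {h : ℝ → ℝ} (hh : ContDiff ℝ ∞ h) (x : EuclideanSpace ℝ (Fin n)) :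
    laplacian (fun y : EuclideanSpace ℝ (Fin n) => h (‖y‖ ^ 2)) x =
      2 * n * deriv h (‖x‖ ^ 2) + 4 * ‖x‖ ^ 2 * deriv (deriv h) (‖x‖ ^ 2) := by
  have hs : ContDiff ℝ ∞ fun y : EuclideanSpace ℝ (Fin n) => h (‖y‖ ^ 2) :=
    hh.comp (contDiff_norm_sq ℝ)
  have hh' : ContDiff ℝ ∞ (deriv h) := (contDiff_infty_iff_deriv.1 hh).2
  rw [laplacian_eq_sum_pderiv (hs.of_le two_le_smooth).contDiffAt]
  have e : ∀ i, pderiv i (pderiv i fun y : EuclideanSpace ℝ (Fin n) => h (‖y‖ ^ 2)) x =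
      2 * deriv h (‖x‖ ^ 2) + 4 * x i ^ 2 * deriv (deriv h) (‖x‖ ^ 2) := by
    intro i
    rw [pderiv_radial hh i, pderiv]
    have h1 : HasFDerivAt (fun y : EuclideanSpace ℝ (Fin n) => y i)
        (EuclideanSpace.proj i : EuclideanSpace ℝ (Fin n) →L[ℝ] ℝ) x :=
      (EuclideanSpace.proj i : EuclideanSpace ℝ (Fin n) →L[ℝ] ℝ).hasFDerivAt
    have h2 : fderiv ℝ (fun y : EuclideanSpace ℝ (Fin n) => 2 * (y i * deriv h (‖y‖ ^ 2))) x = _ :=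
      ((h1.mul (hasFDerivAt_radial hh' x)).const_mul 2).fderiv
    rw [h2]
    simp [EuclideanSpace.inner_single_right]
    ring
  rw [Finset.sum_congr rfl fun i _ => e i, Finset.sum_add_distrib, ← Finset.sum_mul,
    ← Finset.sum_mul, ← Finset.mul_sum, ← EuclideanSpace.real_norm_sq_eq, Finset.sum_const,
    Finset.card_univ, Fintype.card_fin, nsmul_eq_mul]
  ring

/-- A smooth step from `0` (left of `1/2`) to `1` (right of `1`). -/
def smoothStep (t : ℝ) : ℝ := Real.smoothTransition (2 * t - 1)

lemma contDiff_smoothStep : ContDiff ℝ ∞ smoothStep :=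
  Real.smoothTransition.contDiff.comp ((contDiff_const.mul contDiff_id).sub contDiff_const)

lemma smoothStep_monotone : Monotone smoothStep := fun a b h =>
  Real.smoothTransition.monotone (by linarith)

lemma smoothStep_eq_zero {t : ℝ} (h : t ≤ 1 / 2) : smoothStep t = 0 :=
  Real.smoothTransition.zero_of_nonpos (by linarith)

lemma smoothStep_eq_one {t : ℝ} (h : 1 ≤ t) : smoothStep t = 1 :=
  Real.smoothTransition.one_of_one_le (by linarith)

/-- The power `t ^ (-n/2)` smoothly truncated to `0` for `t ≤ s ^ 2 / 2`. -/
def truncPow (n : ℕ) (s t : ℝ) : ℝ := smoothStep (s⁻¹ ^ 2 * t) * t ^ (-(n : ℝ) / 2)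

lemma truncPow_eq_zero {s t : ℝ} (h : s⁻¹ ^ 2 * t ≤ 1 / 2) : truncPow n s t = 0 := by
  rw [truncPow, smoothStep_eq_zero h, zero_mul]

lemma truncPow_eq_rpow {s t : ℝ} (hs : 0 < s) (h : s ^ 2 ≤ t) :
    truncPow n s t = t ^ (-(n : ℝ) / 2) := by
  rw [truncPow, smoothStep_eq_one, one_mul]
  rw [inv_pow, ← div_eq_inv_mul, le_div_iff₀ (by positivity)]
  linarith

lemma contDiff_truncPow (s : ℝ) : ContDiff ℝ ∞ (truncPow n s) := by
  rw [contDiff_iff_contDiffAt]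
  intro t
  rcases le_or_gt t 0 with ht | ht
  · have : truncPow n s =ᶠ[𝓝 t] fun _ => 0 := by
      have h1 : s⁻¹ ^ 2 * t < 1 / 2 :=
        (mul_nonpos_of_nonneg_of_nonpos (sq_nonneg _) ht).trans_lt (by norm_num)
      have h2 : Continuous fun y : ℝ => s⁻¹ ^ 2 * y := by fun_prop
      filter_upwards [h2.continuousAt.eventually_lt_const h1] with y hy
      exact truncPow_eq_zero hy.le
    exact contDiffAt_const.congr_of_eventuallyEq this
  · exact (contDiff_smoothStep.comp (contDiff_const.mul contDiff_id)).contDiffAt.mul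
      (Real.contDiffAt_rpow_const_of_ne ht.ne')

lemma truncPow_anti {r R : ℝ} (hr : 0 < r) (hR : r ≤ R) (t : ℝ) :
    truncPow n R t ≤ truncPow n r t := by
  rcases le_or_gt t 0 with ht | ht
  · have h : ∀ s : ℝ, truncPow n s t = 0 := fun s => truncPow_eq_zero
      ((mul_nonpos_of_nonneg_of_nonpos (sq_nonneg _) ht).trans (by norm_num))
    rw [h, h]
  · unfold truncPow
    have h0 : 0 < R := hr.trans_le hR
    have : R⁻¹ ≤ r⁻¹ := inv_anti₀ hr hR
    refine mul_le_mul_of_nonneg_right (smoothStep_monotone ?_) (by positivity)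
    gcongr

lemma truncPow_scale {s : ℝ} (hs : 0 < s) (t : ℝ) :
    truncPow n s t = s⁻¹ ^ n * truncPow n 1 (s⁻¹ ^ 2 * t) := by
  rcases le_or_gt t 0 with ht | ht
  · have h : s⁻¹ ^ 2 * t ≤ 0 := mul_nonpos_of_nonneg_of_nonpos (sq_nonneg _) ht
    rw [truncPow_eq_zero (h.trans (by norm_num)), truncPow_eq_zero, mul_zero]
    simpa using h.trans (by norm_num)
  · have h1 : (s⁻¹ ^ 2 * t) ^ (-(n : ℝ) / 2) = s ^ n * t ^ (-(n : ℝ) / 2) := by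
      rw [Real.mul_rpow (by positivity) ht.le, ← Real.rpow_natCast s⁻¹ 2, ← Real.rpow_mul (by positivity),
        show ((2 : ℕ) : ℝ) * (-(n : ℝ) / 2) = -n by push_cast; ring, Real.inv_rpow hs.le,
        Real.rpow_neg hs.le, inv_inv, Real.rpow_natCast]
    have h2 : s⁻¹ ^ n * s ^ n = 1 := by rw [← mul_pow, inv_mul_cancel₀ hs.ne', one_pow]
    simp only [truncPow, inv_one, one_pow, one_mul]
    rw [h1]
    linear_combination (-(smoothStep (s⁻¹ ^ 2 * t) * t ^ (-(n : ℝ) / 2))) * h2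

/-- The nonnegative mollifier arising as minus the Laplacian of a smooth truncation of the
fundamental solution. -/
def newtonBump (n : ℕ) (x : EuclideanSpace ℝ (Fin n)) : ℝ :=
  2 * n * truncPow n 1 (‖x‖ ^ 2) + 4 * ‖x‖ ^ 2 * deriv (truncPow n 1) (‖x‖ ^ 2)

lemma contDiff_newtonBump : ContDiff ℝ ∞ (newtonBump n) := by
  have h := contDiff_truncPow (n := n) 1
  have h' : ContDiff ℝ ∞ (deriv (truncPow n 1)) := (contDiff_infty_iff_deriv.1 h).2
  have hN : ContDiff ℝ ∞ fun x : EuclideanSpace ℝ (Fin n) => ‖x‖ ^ 2 := contDiff_norm_sq ℝ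
  exact (contDiff_const.mul (h.comp hN)).add ((contDiff_const.mul hN).mul (h'.comp hN))

lemma newtonBump_eq {x : EuclideanSpace ℝ (Fin n)} (hx : x ≠ 0) :
    newtonBump n x =
      4 * ‖x‖ ^ 2 * deriv smoothStep (‖x‖ ^ 2) * (‖x‖ ^ 2) ^ (-(n : ℝ) / 2) := by
  have ht : 0 < ‖x‖ ^ 2 := by positivity
  set t := ‖x‖ ^ 2 with htd
  have e : truncPow n 1 = fun t => smoothStep t * t ^ (-(n : ℝ) / 2) := by
    funext t; simp [truncPow]
  have h1 : HasDerivAt smoothStep (deriv smoothStep t) t :=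
    (contDiff_smoothStep.differentiable (by simp) t).hasDerivAt
  have h2 := h1.mul (Real.hasDerivAt_rpow_const (x := t) (p := -(n : ℝ) / 2) (Or.inl ht.ne'))
  have h3 : deriv (truncPow n 1) t = deriv smoothStep t * t ^ (-(n : ℝ) / 2) +
      smoothStep t * (-(n : ℝ) / 2 * t ^ (-(n : ℝ) / 2 - 1)) := by
    rw [e]
    exact h2.deriv
  rw [newtonBump, ← htd, h3, e, Real.rpow_sub_one ht.ne']
  field_simp
  ring

lemma newtonBump_zero : newtonBump n 0 = 0 := by
  simp [newtonBump, truncPow_eq_zero]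

lemma newtonBump_nonneg (x : EuclideanSpace ℝ (Fin n)) : 0 ≤ newtonBump n x := by
  rcases eq_or_ne x 0 with rfl | hx
  · exact newtonBump_zero.ge
  · rw [newtonBump_eq hx]
    have := smoothStep_monotone.deriv_nonneg (x := ‖x‖ ^ 2)
    positivity

lemma newtonBump_eq_zero {x : EuclideanSpace ℝ (Fin n)} (hx : 1 < ‖x‖) : newtonBump n x = 0 := by
  have h0 : x ≠ 0 := norm_pos_iff.1 (by linarith)
  have : smoothStep =ᶠ[𝓝 (‖x‖ ^ 2)] fun _ => 1 := by
    filter_upwards [lt_mem_nhds (show 1 < ‖x‖ ^ 2 by nlinarith)] with y hy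
    exact smoothStep_eq_one hy.le
  rw [newtonBump_eq h0, this.deriv_eq]
  simp

lemma exists_newtonBump_pos (hn : 0 < n) : ∃ x, 0 < newtonBump n x := by
  obtain ⟨t, ht, hd⟩ := exists_deriv_eq_slope smoothStep (show (1 / 2 : ℝ) < 1 by norm_num)
    contDiff_smoothStep.continuous.continuousOn
    (contDiff_smoothStep.differentiable (by simp)).differentiableOn
  rw [smoothStep_eq_zero le_rfl, smoothStep_eq_one le_rfl] at hd
  have ht0 : 0 < t := by linarith [ht.1]
  refine ⟨EuclideanSpace.single ⟨0, hn⟩ (Real.sqrt t), ?_⟩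
  have hnorm : ‖(EuclideanSpace.single (⟨0, hn⟩ : Fin n) (Real.sqrt t))‖ ^ 2 = t := by
    simp [Real.sq_sqrt ht0.le]
  rw [newtonBump_eq (fun h => by rw [h] at hnorm; simp at hnorm; linarith), hnorm, hd]
  positivity

/-- The difference of two truncated fundamental solutions: a nonnegative test function whose
negative Laplacian is the difference of two rescaled bumps. -/
lemma exists_newton_test {r R : ℝ} (hr : 0 < r) (hR : r ≤ R) :
    ∃ φ : EuclideanSpace ℝ (Fin n) → ℝ, ContDiff ℝ ∞ φ ∧ (∀ x, 0 ≤ φ x) ∧ HasCompactSupport φ ∧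
      ∀ x, -laplacian φ x =
        r⁻¹ ^ n * newtonBump n (r⁻¹ • x) - R⁻¹ ^ n * newtonBump n (R⁻¹ • x) := by
  have hR0 : 0 < R := hr.trans_le hR
  set q : ℝ → ℝ := fun t => truncPow n r t - truncPow n R t with hq
  have hqs : ContDiff ℝ ∞ q := (contDiff_truncPow r).sub (contDiff_truncPow R)
  have hq0 : ∀ t, 0 ≤ q t := fun t => sub_nonneg.2 (truncPow_anti hr hR t)
  have hqz : ∀ t, R ^ 2 ≤ t → q t = 0 := fun t ht => by
    rw [hq]
    simp only
    rw [truncPow_eq_rpow hr ((by gcongr : r ^ 2 ≤ R ^ 2).trans ht), truncPow_eq_rpow hR0 ht, sub_self]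
  set h : ℝ → ℝ := fun s => -∫ t in (R ^ 2)..s, q t with hh
  have hd : ∀ s, HasDerivAt h (-q s) s := fun s =>
    (intervalIntegral.integral_hasDerivAt_right (hqs.continuous.intervalIntegrable _ _)
      (hqs.continuous.stronglyMeasurableAtFilter _ _) hqs.continuous.continuousAt).neg
  have hd' : deriv h = fun s => -q s := funext fun s => (hd s).deriv
  have hhs : ContDiff ℝ ∞ h := by
    rw [contDiff_infty_iff_deriv, hd']
    exact ⟨fun s => (hd s).differentiableAt, hqs.neg⟩
  have hz : ∀ s, R ^ 2 ≤ s → h s = 0 := fun s hs => by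
    rw [hh]
    simp only [neg_eq_zero]
    rw [intervalIntegral.integral_congr (g := fun _ => 0) fun t ht => ?_]
    · simp
    · rw [Set.uIcc_of_le hs] at ht
      exact hqz t ht.1
  refine ⟨fun x => h (‖x‖ ^ 2), hhs.comp (contDiff_norm_sq ℝ), fun x => ?_, ?_, fun x => ?_⟩
  · rcases le_total (R ^ 2) (‖x‖ ^ 2) with hx | hx
    · exact (hz _ hx).ge
    · rw [hh]
      simp only
      rw [← intervalIntegral.integral_symm]
      exact intervalIntegral.integral_nonneg hx fun t _ => hq0 t
  · refine hasCompactSupport_of_norm (a := 0) (r := R) fun y hy => hz _ ?_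
    rw [sub_zero] at hy
    gcongr
  · rw [laplacian_radial hhs, hd']
    have key : ∀ s : ℝ, 0 < s → s⁻¹ ^ n * newtonBump n (s⁻¹ • x) =
        2 * n * truncPow n s (‖x‖ ^ 2) + 4 * ‖x‖ ^ 2 * deriv (truncPow n s) (‖x‖ ^ 2) := by
      intro s hs
      have e : truncPow n s = fun t => s⁻¹ ^ n * truncPow n 1 (s⁻¹ ^ 2 * t) :=
        funext (truncPow_scale hs)
      have h1 : HasDerivAt (truncPow n 1) (deriv (truncPow n 1) (s⁻¹ ^ 2 * ‖x‖ ^ 2))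
          (s⁻¹ ^ 2 * ‖x‖ ^ 2) :=
        ((contDiff_truncPow 1).differentiable (by simp) _).hasDerivAt
      have h2 := (h1.comp (‖x‖ ^ 2) ((hasDerivAt_id (‖x‖ ^ 2)).const_mul (s⁻¹ ^ 2))).const_mul
        (s⁻¹ ^ n)
      have h3 : deriv (truncPow n s) (‖x‖ ^ 2) =
          s⁻¹ ^ n * (deriv (truncPow n 1) (s⁻¹ ^ 2 * ‖x‖ ^ 2) * (s⁻¹ ^ 2 * 1)) := by
        rw [e]
        exact h2.deriv
      rw [h3, e, newtonBump, norm_smul, Real.norm_of_nonneg (by positivity), mul_pow]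
      ring
    rw [key r hr, key R hR0]
    have h4 : deriv (fun s => -q s) (‖x‖ ^ 2) =
        -(deriv (truncPow n r) (‖x‖ ^ 2) - deriv (truncPow n R) (‖x‖ ^ 2)) :=
      ((((contDiff_truncPow r).differentiable (by simp) _).hasDerivAt).sub
        (((contDiff_truncPow R).differentiable (by simp) _).hasDerivAt)).neg.deriv
    rw [h4, hq]
    ring

end Radial

section Growth

variable {n : ℕ} {χ g : EuclideanSpace ℝ (Fin n) → ℝ}

lemma exists_pderiv_pow_mul (hχ : ContDiff ℝ ∞ χ) (hg : ContDiff ℝ ∞ g) (m : ℕ) (i : Fin n) :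
    ∃ h : EuclideanSpace ℝ (Fin n) → ℝ, ContDiff ℝ ∞ h ∧
      pderiv i (fun y => χ y ^ (m + 1) * g y) = fun y => χ y ^ m * h y := by
  refine ⟨fun y => χ y * pderiv i g y + (m + 1) * (g y * pderiv i χ y),
    (hχ.mul (hg.pderiv i)).add (contDiff_const.mul (hg.mul (hχ.pderiv i))), ?_⟩
  funext y
  have h1 := (hχ.differentiable (by simp) y).hasFDerivAt
  have h2 := (hg.differentiable (by simp) y).hasFDerivAt
  have h3 : fderiv ℝ (fun y => χ y ^ (m + 1) * g y) y = _ := ((h1.pow (m + 1)).mul h2).fderiv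
  rw [pderiv, h3]
  simp [pderiv]
  ring

/-- Applying `(-Δ)^j` to a power of `χ` lowers the exponent by at most `2j`. -/
lemma exists_negLapPow_pow_mul (hχ : ContDiff ℝ ∞ χ) (hg : ContDiff ℝ ∞ g) (m j : ℕ) :
    ∃ h : EuclideanSpace ℝ (Fin n) → ℝ, ContDiff ℝ ∞ h ∧
      negLapPow j (fun y => χ y ^ (m + 2 * j) * g y) = fun y => χ y ^ m * h y := by
  induction j generalizing m with
  | zero => exact ⟨g, hg, rfl⟩
  | succ j ih =>
    obtain ⟨h, hh, he⟩ := ih (m + 2)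
    choose a ha hae using fun i => exists_pderiv_pow_mul hχ hh (m + 1) i
    choose b hb hbe using fun i => exists_pderiv_pow_mul hχ (ha i) m i
    refine ⟨fun y => -∑ i, b i y, (ContDiff.sum fun i _ => hb i).neg, ?_⟩
    rw [negLapPow_succ, show m + 2 * (j + 1) = m + 2 + 2 * j by ring, he]
    funext x
    rw [laplacian_eq_sum_pderiv (((hχ.pow (m + 2)).mul hh).of_le two_le_smooth).contDiffAt]
    simp only [hae, hbe, mul_neg, Finset.mul_sum]

/-- Absorption: a multiple of `χ ^ N * t` is controlled by a small multiple of `χ ^ m * t ^ p`. -/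
lemma exists_absorb {p c H : ℝ} {N m : ℕ} (hp : 1 < p) (hc : 0 < c) (hH : 0 ≤ H)
    (hm : (m : ℝ) ≤ N * p) : ∃ A, 0 ≤ A ∧ ∀ s t : ℝ, 0 ≤ s → s ≤ 1 → 0 < t →
      H * (s ^ N * t) ≤ c * (t ^ p * s ^ m) + A := by
  refine ⟨H * (H / c) ^ (1 / (p - 1)), by positivity, fun s t hs0 hs1 ht => ?_⟩
  set q := s ^ N * t with hq
  have hq0 : 0 ≤ q := by positivity
  have h1 : q ^ p ≤ t ^ p * s ^ m := by
    rw [hq, Real.mul_rpow (by positivity) ht.le, ← Real.rpow_natCast_mul hs0, mul_comm,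
      ← Real.rpow_natCast s m]
    have := Real.rpow_le_rpow_of_exponent_ge' hs0 hs1 (Nat.cast_nonneg m) hm
    gcongr
  have hA : 0 ≤ H * (H / c) ^ (1 / (p - 1)) := by positivity
  have h2 : H * q ≤ c * q ^ p + H * (H / c) ^ (1 / (p - 1)) := by
    rcases le_total q ((H / c) ^ (1 / (p - 1))) with h | h
    · have : 0 ≤ c * q ^ p := by positivity
      nlinarith
    · have h3 : H / c ≤ q ^ (p - 1) := by
        have := Real.rpow_le_rpow (by positivity) h (show 0 ≤ p - 1 by linarith)
        rwa [← Real.rpow_mul (by positivity), one_div, inv_mul_cancel₀ (by linarith),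
          Real.rpow_one] at this
      have h4 : q ^ p = q ^ (p - 1) * q := by
        rw [← Real.rpow_add_one' hq0 (by linarith)]
        simp
      rw [div_le_iff₀ hc] at h3
      rw [h4]
      nlinarith
  nlinarith

/-- A cutoff at scale `R` (raised to the power `m`) that vanishes near the origin. -/
def annularCutoff (n m : ℕ) (R : ℝ) (x : EuclideanSpace ℝ (Fin n)) : ℝ :=
  cutoff n (R⁻¹ • x) ^ m - cutoff n x

lemma contDiff_annularCutoff (m : ℕ) (R : ℝ) : ContDiff ℝ ∞ (annularCutoff n m R) :=
  ((contDiff_cutoff.comp (contDiff_const_smul R⁻¹)).pow m).sub contDiff_cutoff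

lemma cutoff_inv_smul_eq_one {R : ℝ} (hR : 0 < R) {x : EuclideanSpace ℝ (Fin n)} (hx : ‖x‖ ≤ R) :
    cutoff n (R⁻¹ • x) = 1 :=
  cutoff_eq_one (by rwa [norm_inv_smul hR, div_le_one hR])

lemma cutoff_inv_smul_eq_zero {R : ℝ} (hR : 0 < R) {x : EuclideanSpace ℝ (Fin n)}
    (hx : 2 * R ≤ ‖x‖) : cutoff n (R⁻¹ • x) = 0 :=
  cutoff_eq_zero (by rwa [norm_inv_smul hR, le_div_iff₀ hR])

lemma annularCutoff_nonneg (m : ℕ) {R : ℝ} (hR : 2 ≤ R) (x : EuclideanSpace ℝ (Fin n)) :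
    0 ≤ annularCutoff n m R x := by
  rw [annularCutoff]
  rcases le_total ‖x‖ 2 with h | h
  · rw [cutoff_inv_smul_eq_one (by linarith) (h.trans hR), one_pow]
    linarith [cutoff_le_one x]
  · rw [cutoff_eq_zero h, sub_zero]
    exact pow_nonneg (cutoff_nonneg _) _

lemma annularCutoff_eq_zero_of_norm_le {m : ℕ} {R : ℝ} (hR : 1 ≤ R)
    {x : EuclideanSpace ℝ (Fin n)} (hx : ‖x‖ ≤ 1) : annularCutoff n m R x = 0 := by
  rw [annularCutoff, cutoff_inv_smul_eq_one (by linarith) (hx.trans hR), cutoff_eq_one hx]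
  simp

lemma annularCutoff_eq_zero_of_le_norm {m : ℕ} (hm : m ≠ 0) {R : ℝ} (hR : 1 ≤ R)
    {x : EuclideanSpace ℝ (Fin n)} (hx : 2 * R ≤ ‖x‖) : annularCutoff n m R x = 0 := by
  rw [annularCutoff, cutoff_inv_smul_eq_zero (by linarith) hx, cutoff_eq_zero (by linarith),
    zero_pow hm, sub_zero]

lemma annularCutoff_eq_one {m : ℕ} {R : ℝ}
    {x : EuclideanSpace ℝ (Fin n)} (hx : 2 ≤ ‖x‖) (hx' : ‖x‖ ≤ R) : annularCutoff n m R x = 1 := by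
  rw [annularCutoff, cutoff_inv_smul_eq_one (by linarith) hx', cutoff_eq_zero hx]
  simp

lemma hasCompactSupport_annularCutoff {m : ℕ} (hm : m ≠ 0) {R : ℝ} (hR : 1 ≤ R) :
    HasCompactSupport (annularCutoff n m R) :=
  hasCompactSupport_of_norm (a := 0) (r := 2 * R) fun y hy =>
    annularCutoff_eq_zero_of_le_norm hm hR (by simpa using hy.le)

lemma tsupport_annularCutoff_subset (m : ℕ) {R : ℝ} (hR : 1 ≤ R) :
    tsupport (annularCutoff n m R) ⊆ {0}ᶜ := by
  intro x hx h0
  rw [Set.mem_singleton_iff.1 h0] at hx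
  refine notMem_tsupport_iff_eventuallyEq.2 ?_ hx
  filter_upwards [Metric.ball_mem_nhds (0 : EuclideanSpace ℝ (Fin n)) one_pos] with y hy
  exact annularCutoff_eq_zero_of_norm_le hR (by simpa using (Metric.mem_ball.1 hy).le)

lemma integrable_annularCutoff_mul {m : ℕ} (hm : m ≠ 0) {R : ℝ} (hR : 1 ≤ R)
    {w : EuclideanSpace ℝ (Fin n) → ℝ} (hw : ContinuousOn w {0}ᶜ) :
    Integrable fun x => annularCutoff n m R x * w x :=
  integrable_mul_of_continuousOn isOpen_compl_singleton (contDiff_annularCutoff m R).continuous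
    (hasCompactSupport_annularCutoff hm hR) (tsupport_annularCutoff_subset m hR) hw

/-- The indicator of the closed ball of radius `r` about the origin. -/
def ballInd (n : ℕ) (r : ℝ) : EuclideanSpace ℝ (Fin n) → ℝ :=
  (Metric.closedBall 0 r).indicator 1

lemma ballInd_of_le {r : ℝ} {x : EuclideanSpace ℝ (Fin n)} (h : ‖x‖ ≤ r) : ballInd n r x = 1 := by
  simp [ballInd, h]

lemma ballInd_of_lt {r : ℝ} {x : EuclideanSpace ℝ (Fin n)} (h : r < ‖x‖) : ballInd n r x = 0 := by
  simp [ballInd, h]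

lemma ballInd_nonneg (r : ℝ) (x : EuclideanSpace ℝ (Fin n)) : 0 ≤ ballInd n r x :=
  Set.indicator_nonneg (fun _ _ => zero_le_one) x

lemma integrable_ballInd (r : ℝ) : Integrable (ballInd n r) :=
  (integrable_indicator_iff Metric.isClosed_closedBall.measurableSet).2
    (integrableOn_const (isCompact_closedBall _ _).measure_lt_top.ne)

lemma integral_ballInd {r : ℝ} (hr : 0 ≤ r) : ∫ x, ballInd n r x =
    r ^ n * volume.real (Metric.ball (0 : EuclideanSpace ℝ (Fin n)) 1) := by
  rw [ballInd, integral_indicator_one Metric.isClosed_closedBall.measurableSet,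
    volume_real_closedBall _ hr]

variable {u : EuclideanSpace ℝ (Fin n) → ℝ}

lemma exists_negLapPow_annularCutoff_mul_le (k : ℕ) {N : ℕ} (hN : N ≠ 0) (hu0 : ∀ x, 0 < u x)
    (hu : Continuous u) {p c : ℝ} (hp : 1 < p) (hc : 0 < c)
    (hm : ((N + 2 * k : ℕ) : ℝ) ≤ N * p) :
    ∃ M A, 0 ≤ M ∧ 0 ≤ A ∧ ∀ R, 2 ≤ R → ∀ x,
      negLapPow k (annularCutoff n (N + 2 * k) R) x * u x ≤ M * ballInd n 2 x +
        R⁻¹ ^ (2 * k) * (c * (annularCutoff n (N + 2 * k) R x * u x ^ p)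
          + A * ballInd n (2 * R) x) := by
  obtain ⟨h, hh, he⟩ := exists_negLapPow_pow_mul (n := n) contDiff_cutoff
    (contDiff_const (c := (1 : ℝ))) N k
  obtain ⟨H, hH⟩ := (isCompact_closedBall (0 : EuclideanSpace ℝ (Fin n)) 2).exists_bound_of_continuousOn
    hh.continuous.continuousOn
  have hH0 : 0 ≤ H := (norm_nonneg _).trans (hH 0 (by simp))
  have hlap : Continuous (negLapPow k (cutoff n)) := (contDiff_cutoff.negLapPow k).continuous
  have hup : Continuous fun x => u x ^ p := hu.rpow_const fun x => Or.inl (hu0 x).ne'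
  obtain ⟨M₁, hM₁⟩ := (isCompact_closedBall (0 : EuclideanSpace ℝ (Fin n)) 2).exists_bound_of_continuousOn
    (hlap.mul hu).continuousOn
  obtain ⟨M₂, hM₂⟩ := (isCompact_closedBall (0 : EuclideanSpace ℝ (Fin n)) 2).exists_bound_of_continuousOn
    hup.continuousOn
  have hM₁0 : 0 ≤ M₁ := (norm_nonneg _).trans (hM₁ 0 (by simp))
  have hM₂0 : 0 ≤ M₂ := (norm_nonneg _).trans (hM₂ 0 (by simp))
  obtain ⟨A, hA0, hA⟩ := exists_absorb hp hc hH0 hm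
  refine ⟨M₁ + c * M₂, A, by positivity, hA0, fun R hR x => ?_⟩
  have hR0 : 0 < R := by linarith
  set ρ := R⁻¹ ^ (2 * k) with hρ
  have hρ0 : 0 ≤ ρ := by positivity
  have hρ1 : ρ ≤ 1 := pow_le_one₀ (by positivity) (inv_le_one_of_one_le₀ (by linarith))
  have e1 : negLapPow k (annularCutoff n (N + 2 * k) R) x =
      ρ * (cutoff n (R⁻¹ • x) ^ N * h (R⁻¹ • x)) - negLapPow k (cutoff n) x := by
    have h1 : ContDiff ℝ ∞ fun y => cutoff n y ^ (N + 2 * k) := contDiff_cutoff.pow _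
    have h2 : ContDiff ℝ ∞ fun y => cutoff n (R⁻¹ • y) ^ (N + 2 * k) :=
      h1.comp (contDiff_const_smul R⁻¹)
    simp only [mul_one] at he
    change negLapPow k (fun y => cutoff n (R⁻¹ • y) ^ (N + 2 * k) - cutoff n y) x = _
    rw [negLapPow_sub h2 contDiff_cutoff, negLapPow_comp_smul h1, he]
  set s := cutoff n (R⁻¹ • x) with hs
  have hs0 : 0 ≤ s := cutoff_nonneg _
  have hs1 : s ≤ 1 := cutoff_le_one _
  have e2 : annularCutoff n (N + 2 * k) R x = s ^ (N + 2 * k) - cutoff n x := rfl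
  have hup0 : 0 ≤ u x ^ p := (Real.rpow_pos_of_pos (hu0 x) p).le
  have b1 : -(negLapPow k (cutoff n) x * u x) ≤ M₁ * ballInd n 2 x := by
    rcases le_or_gt ‖x‖ 2 with h | h
    · rw [ballInd_of_le h, mul_one]
      exact (neg_le_abs _).trans (hM₁ x (by simpa using h))
    · rw [ballInd_of_lt h, negLapPow_eq_zero_of_notMem_tsupport]
      · simp
      · intro hx
        have := tsupport_subset_closedBall (f := cutoff n) (a := 0) (r := 2)
          (fun y hy => cutoff_eq_zero (by simpa using hy.le)) hx
        simp at this
        linarith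
  have b2 : cutoff n x * u x ^ p ≤ M₂ * ballInd n 2 x := by
    rcases le_or_gt ‖x‖ 2 with h | h
    · rw [ballInd_of_le h, mul_one]
      have h3 := (le_abs_self _).trans (hM₂ x (by simpa using h))
      have h4 := cutoff_le_one x
      nlinarith
    · rw [ballInd_of_lt h, cutoff_eq_zero h.le]
      simp
  have b3 : s ^ N * h (R⁻¹ • x) * u x ≤
      c * (s ^ (N + 2 * k) * u x ^ p) + A * ballInd n (2 * R) x := by
    rcases le_or_gt ‖x‖ (2 * R) with h' | h'
    · rw [ballInd_of_le h', mul_one]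
      have h3 := (le_abs_self _).trans (hH (R⁻¹ • x) (by
        rw [mem_closedBall_zero_iff, norm_inv_smul hR0, div_le_iff₀ hR0]
        exact h'))
      have h4 := hA s (u x) hs0 hs1 (hu0 x)
      have h5 : 0 ≤ s ^ N * u x := mul_nonneg (pow_nonneg hs0 _) (hu0 x).le
      nlinarith
    · rw [ballInd_of_lt h', hs, cutoff_inv_smul_eq_zero hR0 h'.le, zero_pow hN, zero_pow (by omega)]
      simp
  have b4 : 0 ≤ M₂ * ballInd n 2 x := mul_nonneg hM₂0 (ballInd_nonneg _ _)
  rw [e1, e2]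
  have b5 := mul_le_mul_of_nonneg_left b3 hρ0
  have b6 : ρ * (c * (cutoff n x * u x ^ p)) ≤ c * (M₂ * ballInd n 2 x) := by
    have h6 : c * (cutoff n x * u x ^ p) ≤ c * (M₂ * ballInd n 2 x) := by gcongr
    have h7 : 0 ≤ c * (cutoff n x * u x ^ p) := by
      have := cutoff_nonneg x
      positivity
    nlinarith
  linarith

/-- A priori bound: under a superlinear lower bound for `∑ (-Δ)^k u_i`, the integral of each `u_i`
over the ball of radius `R` grows at most like the volume of the ball. -/
lemma exists_integral_closedBall_le {k L : ℕ} (hkn : 2 * k ≤ n)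
    {u : Fin L → EuclideanSpace ℝ (Fin n) → ℝ} (hu0 : ∀ i x, 0 < u i x)
    (hu : ∀ i, Continuous (u i))
    (hus : ∀ i, ContDiffOn ℝ ((2 * k : ℕ) : WithTop ℕ∞) (u i) {0}ᶜ)
    {p : Fin L → ℝ} (hp : ∀ i, 1 < p i) {c : ℝ} (hc : 0 < c)
    (hlow : ∀ R, 1 ≤ R → ∀ x, 1 ≤ ‖x‖ → ‖x‖ ≤ 2 * R →
      c * R⁻¹ ^ (2 * k) * ∑ i, u i x ^ p i ≤ ∑ i, negLapPow k (u i) x) (i : Fin L) :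
    ∃ K, ∀ R, 2 ≤ R → ∫ x in Metric.closedBall 0 R, u i x ≤ K * R ^ n := by
  obtain ⟨N, hN0, hN⟩ : ∃ N : ℕ, N ≠ 0 ∧ ∀ i, ((N + 2 * k : ℕ) : ℝ) ≤ N * p i := by
    choose N hN using fun i => exists_nat_ge (2 * k / (p i - 1))
    refine ⟨∑ i, N i + 1, by omega, fun i => ?_⟩
    have h1 : N i ≤ ∑ i, N i := Finset.single_le_sum (fun _ _ => Nat.zero_le _) (Finset.mem_univ i)
    have h2 : (N i : ℝ) ≤ ((∑ i, N i : ℕ) : ℝ) := by exact_mod_cast h1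
    have h3 := hp i
    have h4 := hN i
    rw [div_le_iff₀ (by linarith)] at h4
    push_cast at h2 ⊢
    nlinarith
  choose M A hM0 hA0 hMA using fun i =>
    exists_negLapPow_annularCutoff_mul_le (n := n) k hN0 (hu0 i) (hu i) (hp i) (half_pos hc) (hN i)
  obtain ⟨B, hB⟩ := (isCompact_closedBall (0 : EuclideanSpace ℝ (Fin n)) 2).exists_bound_of_continuousOn
    (hu i).continuousOn
  have hB0 : 0 ≤ B := (norm_nonneg _).trans (hB 0 (by simp))
  set V := volume.real (Metric.ball (0 : EuclideanSpace ℝ (Fin n)) 1) with hV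
  have hV0 : 0 ≤ V := measureReal_nonneg
  set D := ∑ i, (M i * (2 ^ n * V) + A i * (2 ^ n * V)) with hD
  refine ⟨B * V * 2 ^ n + V + 2 * D / c, fun R hR => ?_⟩
  have hR1 : 1 ≤ R := by linarith
  have hR0 : 0 < R := by linarith
  set m := N + 2 * k with hm
  have hm0 : m ≠ 0 := by omega
  set φ := annularCutoff n m R with hφ
  have hφ0 : ∀ x, 0 ≤ φ x := annularCutoff_nonneg m hR
  have hup : ∀ i, Continuous fun x => u i x ^ p i := fun i =>
    (hu i).rpow_const fun x => Or.inl (hu0 i x).ne'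
  have hup0 : ∀ i x, 0 < u i x ^ p i := fun i x => Real.rpow_pos_of_pos (hu0 i x) _
  have hint : ∀ i, Integrable fun x => φ x * u i x ^ p i := fun i =>
    integrable_annularCutoff_mul hm0 hR1 (hup i).continuousOn
  have hlapc : ∀ i, ContinuousOn (negLapPow k (u i)) {0}ᶜ := fun i =>
    (ContDiffOn.negLapPow (m := 0) isOpen_compl_singleton k
      (by simpa using hus i)).continuousOn
  have hintl : ∀ i, Integrable fun x => φ x * negLapPow k (u i) x := fun i =>
    integrable_annularCutoff_mul hm0 hR1 (hlapc i)
  set T := fun i => ∫ x, φ x * u i x ^ p i with hT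
  have hT0 : ∀ i, 0 ≤ T i := fun i => integral_nonneg fun x => mul_nonneg (hφ0 x) (hup0 i x).le
  have hlower : c * R⁻¹ ^ (2 * k) * ∑ i, T i ≤ ∑ i, ∫ x, φ x * negLapPow k (u i) x := by
    rw [hT, ← integral_finsetSum _ fun i _ => hint i, ← integral_finsetSum _ fun i _ => hintl i,
      ← integral_const_mul]
    refine integral_mono ((integrable_finsetSum _ fun i _ => hint i).const_mul _)
      (integrable_finsetSum _ fun i _ => hintl i) fun x => ?_
    simp only [← Finset.mul_sum]
    rcases le_or_gt ‖x‖ 1 with h | h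
    · rw [hφ, annularCutoff_eq_zero_of_norm_le hR1 h]
      simp
    rcases le_or_gt ‖x‖ (2 * R) with h' | h'
    · have := mul_le_mul_of_nonneg_left (hlow R hR1 x h.le h') (hφ0 x)
      linarith
    · rw [hφ, annularCutoff_eq_zero_of_le_norm hm0 hR1 h'.le]
      simp
  have hupper : ∀ i, ∫ x, φ x * negLapPow k (u i) x ≤ M i * (2 ^ n * V) +
      R⁻¹ ^ (2 * k) * (c / 2 * T i + A i * ((2 * R) ^ n * V)) := by
    intro i
    rw [integral_mul_negLapPow isOpen_compl_singleton (contDiff_annularCutoff m R)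
      (hasCompactSupport_annularCutoff hm0 hR1) (tsupport_annularCutoff_subset m hR1) k (hus i)]
    have g1 : Integrable fun x => M i * ballInd n 2 x := (integrable_ballInd 2).const_mul _
    have g2 : Integrable fun x => A i * ballInd n (2 * R) x := (integrable_ballInd _).const_mul _
    have g3 : Integrable fun x => c / 2 * (φ x * u i x ^ p i) := (hint i).const_mul _
    have g4 : Integrable fun x => R⁻¹ ^ (2 * k) *
        (c / 2 * (φ x * u i x ^ p i) + A i * ballInd n (2 * R) x) := (g3.add g2).const_mul _
    calc _ ≤ ∫ x, (M i * ballInd n 2 x + R⁻¹ ^ (2 * k) *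
          (c / 2 * (φ x * u i x ^ p i) + A i * ballInd n (2 * R) x)) := by
          refine integral_mono ?_ (g1.add g4) (hMA i R hR)
          refine integrable_mul_of_continuousOn isOpen_univ
            ((contDiff_annularCutoff m R).negLapPow k).continuous
            ((hasCompactSupport_annularCutoff hm0 hR1).negLapPow k) (Set.subset_univ _)
            (hu i).continuousOn
      _ = _ := by
          rw [integral_add g1 g4, integral_const_mul, integral_const_mul, integral_add g3 g2,
            integral_const_mul, integral_const_mul, integral_ballInd (by norm_num),
            integral_ballInd (by positivity)]
  have hRk : R ^ (2 * k) ≤ R ^ n := pow_le_pow_right₀ hR1 hkn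
  have hRk0 : 0 < R ^ (2 * k) := by positivity
  have hTsum : c / 2 * ∑ i, T i ≤ D * R ^ n := by
    have h1 := hlower.trans (Finset.sum_le_sum fun i _ => hupper i)
    have h2 := mul_le_mul_of_nonneg_left h1 hRk0.le
    have e1 : R ^ (2 * k) * (c * R⁻¹ ^ (2 * k) * ∑ i, T i) = c * ∑ i, T i := by
      rw [inv_pow]
      field_simp
    have e2 : R ^ (2 * k) * ∑ i, (M i * (2 ^ n * V) +
        R⁻¹ ^ (2 * k) * (c / 2 * T i + A i * ((2 * R) ^ n * V))) =
        c / 2 * ∑ i, T i +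
          ∑ i, (R ^ (2 * k) * (M i * (2 ^ n * V)) + R ^ n * (A i * (2 ^ n * V))) := by
      rw [Finset.mul_sum, Finset.mul_sum, ← Finset.sum_add_distrib]
      refine Finset.sum_congr rfl fun i _ => ?_
      rw [inv_pow, mul_pow]
      field_simp
      ring
    rw [e1, e2] at h2
    have h3 : ∑ i, (R ^ (2 * k) * (M i * (2 ^ n * V)) + R ^ n * (A i * (2 ^ n * V))) ≤
        D * R ^ n := by
      rw [hD, Finset.sum_mul]
      refine Finset.sum_le_sum fun i _ => ?_
      have : R ^ (2 * k) * (M i * (2 ^ n * V)) ≤ R ^ n * (M i * (2 ^ n * V)) := by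
        have := hM0 i
        gcongr
      linarith
    linarith
  have hTi : T i ≤ 2 * D / c * R ^ n := by
    have h1 : T i ≤ ∑ i, T i := Finset.single_le_sum (fun j _ => hT0 j) (Finset.mem_univ i)
    rw [div_mul_eq_mul_div, le_div_iff₀ hc]
    nlinarith
  have g1 : Integrable fun x => B * ballInd n 2 x := (integrable_ballInd 2).const_mul _
  have g2 : Integrable (ballInd n R) := integrable_ballInd R
  have g3 : Integrable fun x => B * ballInd n 2 x + ballInd n R x := g1.add g2
  have hfin : ∫ x in Metric.closedBall 0 R, u i x ≤ B * (2 ^ n * V) + R ^ n * V + T i := by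
    rw [← integral_indicator Metric.isClosed_closedBall.measurableSet]
    calc _ ≤ ∫ x, (B * ballInd n 2 x + ballInd n R x + φ x * u i x ^ p i) := by
          refine integral_mono ?_ ((g1.add g2).add (hint i)) fun x => ?_
          · exact (integrable_indicator_iff Metric.isClosed_closedBall.measurableSet).2
              ((hu i).continuousOn.integrableOn_compact (isCompact_closedBall _ _))
          · have n1 := mul_nonneg (hφ0 x) (hup0 i x).le
            have n2 := mul_nonneg hB0 (ballInd_nonneg 2 x)
            have n3 := ballInd_nonneg R x
            rcases le_or_gt ‖x‖ R with h | h
            · rw [Set.indicator_of_mem (by simpa using h)]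
              rcases le_or_gt ‖x‖ 2 with h' | h'
              · have := (le_abs_self _).trans (hB x (by simpa using h'))
                rw [ballInd_of_le h'] at *
                linarith
              · rw [ballInd_of_le h, hφ, annularCutoff_eq_one h'.le h, one_mul]
                have : u i x ≤ 1 + u i x ^ p i := by
                  rcases le_total (u i x) 1 with h1 | h1
                  · linarith [hup0 i x]
                  · linarith [Real.self_le_rpow_of_one_le h1 (hp i).le]
                linarith
            · rw [Set.indicator_of_notMem (by simpa using h)]
              positivity
      _ = _ := by
          rw [integral_add g3 (hint i), integral_add g1 g2, integral_const_mul,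
            integral_ballInd (by norm_num), integral_ballInd hR0.le]
  have hRn : 1 ≤ R ^ n := one_le_pow₀ hR1
  have : B * (2 ^ n * V) ≤ B * (2 ^ n * V) * R ^ n := le_mul_of_one_le_right (by positivity) hRn
  linarith

end Growth

section Positivity

variable {n : ℕ} {f u : EuclideanSpace ℝ (Fin n) → ℝ}

lemma hasDerivAt_line {i : Fin n} {x : EuclideanSpace ℝ (Fin n)} {t : ℝ}
    (hf : DifferentiableAt ℝ f (x + t • EuclideanSpace.single i 1)) :
    HasDerivAt (fun s : ℝ => f (x + s • EuclideanSpace.single i 1))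
      (pderiv i f (x + t • EuclideanSpace.single i 1)) t := by
  have h : HasDerivAt (fun s : ℝ => x + s • EuclideanSpace.single i (1 : ℝ))
      (EuclideanSpace.single i 1) t := by
    simpa using ((hasDerivAt_id t).smul_const (EuclideanSpace.single i (1 : ℝ))).const_add x
  exact hf.hasFDerivAt.comp_hasDerivAt t h

lemma IsLocalMin.laplacian_nonneg {U : Set (EuclideanSpace ℝ (Fin n))} (hU : IsOpen U)
    (hf : ContDiffOn ℝ 2 f U) {x : EuclideanSpace ℝ (Fin n)} (hx : x ∈ U) (hmin : IsLocalMin f x) :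
    0 ≤ laplacian f x := by
  have hxU := hU.mem_nhds hx
  rw [laplacian_eq_sum_pderiv (hf.contDiffAt hxU)]
  refine Finset.sum_nonneg fun i _ => ?_
  by_contra! hneg
  set d := pderiv i (pderiv i f) x with hd
  set e : EuclideanSpace ℝ (Fin n) := EuclideanSpace.single i 1 with he
  have hcont : Continuous fun t : ℝ => x + t • e := by fun_prop
  have htend : Filter.Tendsto (fun t : ℝ => x + t • e) (𝓝 0) (𝓝 x) := by
    simpa using hcont.tendsto 0
  have hd1 : ∀ᶠ t in 𝓝 (0 : ℝ), HasDerivAt (fun s : ℝ => f (x + s • e) + -d / 4 * s ^ 2)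
      (pderiv i f (x + t • e) + -d / 4 * (2 * t)) t := by
    filter_upwards [htend.eventually_mem hxU] with t ht
    have h1 := (hasDerivAt_pow 2 t).const_mul (-d / 4)
    have h2 := hasDerivAt_line
      ((hf.contDiffAt (hU.mem_nhds ht)).differentiableAt (by norm_num)) (i := i)
    exact (h2.add h1).congr_deriv (by simp [he])
  have hpd : DifferentiableAt ℝ (pderiv i f) (x + (0 : ℝ) • e) := by
    have : ContDiffOn ℝ 1 (pderiv i f) U := hf.pderiv hU (by norm_num) i
    simpa using (this.contDiffAt hxU).differentiableAt (by norm_num)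
  have hp0 : pderiv i f x = 0 := by
    rw [pderiv, hmin.fderiv_eq_zero]
    rfl
  have hdd : deriv (deriv fun s : ℝ => f (x + s • e) + -d / 4 * s ^ 2) 0 = d / 2 := by
    have h1 : deriv (fun s : ℝ => f (x + s • e) + -d / 4 * s ^ 2) =ᶠ[𝓝 0]
        fun t => pderiv i f (x + t • e) + -d / 4 * (2 * t) := hd1.mono fun t ht => ht.deriv
    have h2 := (hasDerivAt_line hpd).add (((hasDerivAt_id (0 : ℝ)).const_mul 2).const_mul (-d / 4))
    rw [h1.deriv_eq]
    refine h2.deriv.trans ?_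
    simp only [zero_smul, add_zero]
    linarith
  have hmax := isLocalMax_of_deriv_deriv_neg (by rw [hdd]; linarith)
    (by rw [hd1.self_of_nhds.deriv]; simp [hp0]) hd1.self_of_nhds.continuousAt
  have hev : ∀ᶠ t in 𝓝[≠] (0 : ℝ), False := by
    filter_upwards [(htend.eventually hmin).filter_mono nhdsWithin_le_nhds,
      (hmax : ∀ᶠ t in 𝓝 (0 : ℝ), _).filter_mono nhdsWithin_le_nhds,
      self_mem_nhdsWithin] with t h1 h2 h3
    have h4 : 0 < t ^ 2 := by
      have : t ≠ 0 := h3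
      positivity
    simp at h2
    nlinarith
  exact hev.exists.elim fun _ h => h

/-- The bump `newtonBump` rescaled to mass-preserving size `s` about `a`. -/
def scaledBump (a : EuclideanSpace ℝ (Fin n)) (s : ℝ) (x : EuclideanSpace ℝ (Fin n)) : ℝ :=
  s⁻¹ ^ n * newtonBump n (s⁻¹ • (x - a))

lemma contDiff_scaledBump (a : EuclideanSpace ℝ (Fin n)) (s : ℝ) :
    ContDiff ℝ ∞ (scaledBump a s) :=
  contDiff_const.mul (contDiff_newtonBump.comp
    ((contDiff_id.sub contDiff_const).const_smul _))

lemma scaledBump_eq_zero {a x : EuclideanSpace ℝ (Fin n)} {s : ℝ} (hs : 0 < s)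
    (hx : s < ‖x - a‖) : scaledBump a s x = 0 := by
  rw [scaledBump, newtonBump_eq_zero (by rwa [norm_inv_smul hs, one_lt_div hs]), mul_zero]

lemma tsupport_scaledBump_subset (a : EuclideanSpace ℝ (Fin n)) {s : ℝ} (hs : 0 < s) :
    tsupport (scaledBump a s) ⊆ Metric.closedBall a s :=
  tsupport_subset_closedBall fun _ h => scaledBump_eq_zero hs h

lemma hasCompactSupport_scaledBump (a : EuclideanSpace ℝ (Fin n)) {s : ℝ} (hs : 0 < s) :
    HasCompactSupport (scaledBump a s) :=
  hasCompactSupport_of_norm fun _ h => scaledBump_eq_zero hs h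

lemma scaledBump_nonneg (a : EuclideanSpace ℝ (Fin n)) {s : ℝ} (hs : 0 < s)
    (x : EuclideanSpace ℝ (Fin n)) : 0 ≤ scaledBump a s x :=
  mul_nonneg (by positivity) (newtonBump_nonneg _)

lemma integrable_negLapPow_scaledBump_mul (hu : Continuous u) (a : EuclideanSpace ℝ (Fin n))
    {s : ℝ} (hs : 0 < s) (j : ℕ) : Integrable fun x => negLapPow j (scaledBump a s) x * u x :=
  integrable_mul_of_continuousOn isOpen_univ ((contDiff_scaledBump a s).negLapPow j).continuous
    ((hasCompactSupport_scaledBump a hs).negLapPow j) (Set.subset_univ _) hu.continuousOn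

/-- Monotonicity in the radius of the averages of `u` against `(-Δ)^j` of the scaled bumps. -/
lemma integral_negLapPow_scaledBump_anti {j : ℕ} (hj : 2 * (j + 1) < n) (hu : Continuous u)
    (hus : ContDiffOn ℝ ((2 * (j + 1) : ℕ) : WithTop ℕ∞) u {0}ᶜ)
    (hpos : ∀ x, x ≠ 0 → 0 ≤ negLapPow (j + 1) u x) (a : EuclideanSpace ℝ (Fin n)) {r R : ℝ}
    (hr : 0 < r) (hR : r ≤ R) :
    ∫ x, negLapPow j (scaledBump a R) x * u x ≤ ∫ x, negLapPow j (scaledBump a r) x * u x := by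
  obtain ⟨φ, hφ, hφ0, hφc, hφl⟩ := exists_newton_test (n := n) hr hR
  have hψ : ContDiff ℝ ∞ fun y => φ (y - a) := hφ.comp (contDiff_id.sub contDiff_const)
  have hψc : HasCompactSupport fun y => φ (y - a) :=
    hφc.comp_homeomorph (Homeomorph.subRight a)
  have h := integral_negLapPow_mul_nonneg hj hu hus hpos hψ hψc fun x => hφ0 _
  have e : negLapPow (j + 1) (fun y => φ (y - a)) = fun x =>
      negLapPow j (scaledBump a r) x - negLapPow j (scaledBump a R) x := by
    rw [negLapPow_add, ← negLapPow_sub (contDiff_scaledBump a r) (contDiff_scaledBump a R)]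
    congr 1
    have := negLapPow_comp_affine hφ 1 a 1
    simp only [one_smul, one_pow, one_mul] at this
    rw [this]
    funext y
    exact hφl (y - a)
  simp only [e, sub_mul] at h
  rw [integral_sub (integrable_negLapPow_scaledBump_mul hu a hr j)
    (integrable_negLapPow_scaledBump_mul hu a (hr.trans_le hR) j)] at h
  linarith

lemma exists_neg_integral_scaledBump_le (hu : Continuous u) (hu0 : ∀ x, 0 < u x) {K : ℝ}
    (hK : ∀ R, 2 ≤ R → ∫ x in Metric.closedBall 0 R, u x ≤ K * R ^ n)
    (a : EuclideanSpace ℝ (Fin n)) (j : ℕ) :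
    ∃ B, ∀ R, 1 ≤ R → ‖a‖ ≤ R →
      -∫ x, negLapPow j (scaledBump a R) x * u x ≤ B * R⁻¹ ^ (2 * j) := by
  obtain ⟨B, hB⟩ := (isCompact_closedBall (0 : EuclideanSpace ℝ (Fin n)) 1).exists_bound_of_continuousOn
    (contDiff_newtonBump.negLapPow j).continuous.continuousOn
  have hB0 : 0 ≤ B := (norm_nonneg _).trans (hB 0 (by simp))
  refine ⟨B * K * 2 ^ n, fun R hR haR => ?_⟩
  have hR0 : 0 < R := by linarith
  have hlap : ∀ x, negLapPow j (scaledBump a R) x =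
      R⁻¹ ^ n * (R⁻¹ ^ (2 * j) * negLapPow j (newtonBump n) (R⁻¹ • (x - a))) := by
    intro x
    have h1 : ContDiff ℝ ∞ fun y : EuclideanSpace ℝ (Fin n) => newtonBump n (R⁻¹ • (y - a)) :=
      contDiff_newtonBump.comp ((contDiff_id.sub contDiff_const).const_smul _)
    change negLapPow j (fun y => R⁻¹ ^ n * newtonBump n (R⁻¹ • (y - a))) x = _
    rw [negLapPow_const_mul h1, negLapPow_comp_affine contDiff_newtonBump]
  rw [← integral_neg]
  calc _ ≤ ∫ x, (Metric.closedBall 0 (2 * R)).indicator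
          (fun x => R⁻¹ ^ n * (R⁻¹ ^ (2 * j) * B) * u x) x := by
        refine integral_mono (integrable_negLapPow_scaledBump_mul hu a hR0 j).neg
          ((integrable_indicator_iff Metric.isClosed_closedBall.measurableSet).2
            ((hu.const_mul _).continuousOn.integrableOn_compact (isCompact_closedBall _ _)))
          fun x => ?_
        rcases le_or_gt ‖x - a‖ R with h | h
        · have h1 : ‖x‖ ≤ 2 * R := by
            have := norm_add_le (x - a) a
            rw [sub_add_cancel] at this
            linarith
          have h2 := (neg_le_abs _).trans (hB (R⁻¹ • (x - a)) (by
            rw [mem_closedBall_zero_iff, norm_inv_smul hR0, div_le_one hR0]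
            exact h))
          rw [Set.indicator_of_mem (by simpa using h1), hlap]
          simp only
          rw [← neg_mul, ← mul_neg, ← mul_neg]
          have := (hu0 x).le
          gcongr
        · have h1 : negLapPow j (scaledBump a R) x = 0 := by
            refine negLapPow_eq_zero_of_notMem_tsupport j fun hx => ?_
            have := tsupport_scaledBump_subset a hR0 hx
            rw [Metric.mem_closedBall, dist_eq_norm] at this
            linarith
          simp only [h1, zero_mul, neg_zero]
          refine Set.indicator_nonneg (fun x _ => ?_) x
          have := (hu0 x).le
          positivity
    _ = R⁻¹ ^ n * (R⁻¹ ^ (2 * j) * B) * ∫ x in Metric.closedBall 0 (2 * R), u x := by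
        rw [integral_indicator Metric.isClosed_closedBall.measurableSet, integral_const_mul]
    _ ≤ R⁻¹ ^ n * (R⁻¹ ^ (2 * j) * B) * (K * (2 * R) ^ n) := by
        gcongr
        exact hK _ (by linarith)
    _ = _ := by
        rw [mul_pow, inv_pow, inv_pow]
        field_simp

lemma negLapPow_nonneg_of_succ {j : ℕ} (hj0 : j ≠ 0) (hj : 2 * (j + 1) < n) (hu : Continuous u)
    (hu0 : ∀ x, 0 < u x) (hus : ContDiffOn ℝ ((2 * (j + 1) : ℕ) : WithTop ℕ∞) u {0}ᶜ)
    (hpos : ∀ x, x ≠ 0 → 0 ≤ negLapPow (j + 1) u x) {K : ℝ}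
    (hK : ∀ R, 2 ≤ R → ∫ x in Metric.closedBall 0 R, u x ≤ K * R ^ n)
    {a : EuclideanSpace ℝ (Fin n)} (ha : a ≠ 0) : 0 ≤ negLapPow j u a := by
  by_contra! hneg
  have hU : IsOpen ({0}ᶜ : Set (EuclideanSpace ℝ (Fin n))) := isOpen_compl_singleton
  have husj : ContDiffOn ℝ ((2 * j : ℕ) : WithTop ℕ∞) u {0}ᶜ :=
    hus.of_le (by exact_mod_cast (by omega : 2 * j ≤ 2 * (j + 1)))
  have hw : ContinuousOn (negLapPow j u) {0}ᶜ :=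
    (ContDiffOn.negLapPow (m := 0) hU j (by simpa using husj)).continuousOn
  obtain ⟨r, hr, hball⟩ : ∃ r, 0 < r ∧
      Metric.closedBall a r ⊆ {0}ᶜ ∩ negLapPow j u ⁻¹' Set.Iio 0 :=
    Metric.nhds_basis_closedBall.mem_iff.1
      ((hw.isOpen_inter_preimage hU isOpen_Iio).mem_nhds ⟨ha, hneg⟩)
  have hsupp : tsupport (scaledBump a r) ⊆ {0}ᶜ := fun x hx =>
    (hball (tsupport_scaledBump_subset a hr hx)).1
  have hI : ∫ x, negLapPow j (scaledBump a r) x * u x < 0 := by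
    rw [← integral_mul_negLapPow hU (contDiff_scaledBump a r) (hasCompactSupport_scaledBump a hr)
      hsupp j husj, ← neg_pos, ← integral_neg]
    obtain ⟨z, hz⟩ := exists_newtonBump_pos (n := n) (by omega)
    have hz1 : ‖z‖ ≤ 1 := not_lt.1 fun h => hz.ne' (newtonBump_eq_zero h)
    refine Continuous.integral_pos_of_hasCompactSupport_nonneg_nonzero (x := a + r • z) ?_ ?_ ?_ ?_
    · refine (ContinuousOn.continuous_of_tsupport_subset
        ((contDiff_scaledBump a r).continuous.continuousOn.mul hw) hU ?_).neg
      exact tsupport_mul_subset_left.trans hsupp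
    · exact (hasCompactSupport_scaledBump a hr).mul_right.neg
    · intro x
      rcases le_or_gt ‖x - a‖ r with h | h
      · have h1 : negLapPow j u x < 0 := (hball (by simpa [dist_eq_norm] using h)).2
        have := scaledBump_nonneg a hr x
        simp only [Pi.zero_apply]
        nlinarith
      · simp [scaledBump_eq_zero hr h]
    · have h1 : negLapPow j u (a + r • z) < 0 := by
        refine (hball ?_).2
        rw [Metric.mem_closedBall, dist_eq_norm, add_sub_cancel_left, norm_smul,
          Real.norm_of_nonneg hr.le]
        nlinarith
      have h2 : 0 < scaledBump a r (a + r • z) := by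
        rw [scaledBump, add_sub_cancel_left, inv_smul_smul₀ hr.ne']
        positivity
      exact neg_ne_zero.2 (mul_neg_of_pos_of_neg h2 h1).ne
  obtain ⟨B, hB⟩ := exists_neg_integral_scaledBump_le hu hu0 hK a j
  have hlim : Filter.Tendsto (fun R : ℝ => B * R⁻¹ ^ (2 * j)) Filter.atTop (𝓝 0) := by
    simpa [hj0] using (tendsto_inv_atTop_zero.pow (2 * j)).const_mul B
  have := ge_of_tendsto hlim (b := -∫ x, negLapPow j (scaledBump a r) x * u x) <| by
    filter_upwards [Filter.eventually_ge_atTop 1, Filter.eventually_ge_atTop ‖a‖,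
      Filter.eventually_ge_atTop r] with R h1 h2 h3
    have := integral_negLapPow_scaledBump_anti hj hu hus hpos a hr h3
    linarith [hB R h1 h2]
  linarith

lemma negLapPow_pos_of_succ {j : ℕ} (hj0 : j ≠ 0) (hj : 2 * (j + 1) < n) (hu : Continuous u)
    (hu0 : ∀ x, 0 < u x) (hus : ContDiffOn ℝ ((2 * (j + 1) : ℕ) : WithTop ℕ∞) u {0}ᶜ)
    (hpos : ∀ x, x ≠ 0 → 0 < negLapPow (j + 1) u x) {K : ℝ}
    (hK : ∀ R, 2 ≤ R → ∫ x in Metric.closedBall 0 R, u x ≤ K * R ^ n)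
    {a : EuclideanSpace ℝ (Fin n)} (ha : a ≠ 0) : 0 < negLapPow j u a := by
  have hnn : ∀ x, x ≠ 0 → 0 ≤ negLapPow j u x := fun x hx =>
    negLapPow_nonneg_of_succ hj0 hj hu hu0 hus (fun x hx => (hpos x hx).le) hK hx
  refine (hnn a ha).lt_of_ne fun h0 => ?_
  have hU : IsOpen ({0}ᶜ : Set (EuclideanSpace ℝ (Fin n))) := isOpen_compl_singleton
  have hw : ContDiffOn ℝ 2 (negLapPow j u) {0}ᶜ :=
    ContDiffOn.negLapPow (m := 2) hU j (by convert hus using 3; ring)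
  have hmin : IsLocalMin (negLapPow j u) a := by
    filter_upwards [hU.mem_nhds ha] with x hx
    rw [← h0]
    exact hnn x hx
  have h1 := hmin.laplacian_nonneg hU hw ha
  have h2 := hpos a ha
  rw [negLapPow_succ] at h2
  linarith

end Positivity

theorem stmt_16 (n k L : ℕ) (hk : 2 ≤ k) (hn : 2 * k < n) (hL : 1 ≤ L)
    (σi : Fin L → ℝ) (hσi : ∀ i, 0 ≤ σi i ∧ σi i < 2 * (k : ℝ))
    (f : Fin L → EuclideanSpace ℝ (Fin n) × (Fin L → ℝ) → ℝ)
    (hf : ∀ i, Continuous (f i))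
    (u : Fin L → EuclideanSpace ℝ (Fin n) → ℝ)
    (hupos : ∀ i x, 0 < u i x)
    (hucont : ∀ i, Continuous (u i))
    (husmooth : ∀ i, ContDiffOn ℝ (2 * k) (u i) {(0 : EuclideanSpace ℝ (Fin n))}ᶜ)
    (heq : ∀ i, ∀ x : EuclideanSpace ℝ (Fin n), x ≠ 0 →
      negLapPow k (u i) x = ‖x‖ ^ (-(σi i)) * f i (x, fun j => u j x))
    (hfpos : ∀ i x, 0 < f i (x, fun j => u j x))
    (p : Fin L → ℝ) (hp : ∀ i, 1 < p i) (σ : ℝ) (hσ : 0 ≤ σ ∧ σ < 2 * (k : ℝ))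
    (C : ℝ) (hC : 0 < C)
    (hlower : ∀ x : EuclideanSpace ℝ (Fin n), x ≠ 0 →
      C * ‖x‖ ^ (-σ) * ∑ i, u i x ^ p i ≤
        ∑ i, ‖x‖ ^ (-(σi i)) * f i (x, fun j => u j x)) :
    ∀ x : EuclideanSpace ℝ (Fin n), x ≠ 0 →
      ∀ i, ∀ j : ℕ, 1 ≤ j → j ≤ k - 1 → 0 < negLapPow j (u i) x := by

  have hus : ∀ i, ContDiffOn ℝ ((2 * k : ℕ) : WithTop ℕ∞) (u i) {0}ᶜ := fun i => by
    exact_mod_cast husmooth i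
  have hlow : ∀ R : ℝ, 1 ≤ R → ∀ x : EuclideanSpace ℝ (Fin n), 1 ≤ ‖x‖ → ‖x‖ ≤ 2 * R →
      C * 2⁻¹ ^ (2 * k) * R⁻¹ ^ (2 * k) * ∑ i, u i x ^ p i ≤ ∑ i, negLapPow k (u i) x := by
    intro R hR x hx1 hx2
    have hx0 : x ≠ 0 := norm_pos_iff.1 (by linarith)
    rw [Finset.sum_congr rfl fun i _ => heq i x hx0]
    refine le_trans ?_ (hlower x hx0)
    have hsum : 0 ≤ ∑ i, u i x ^ p i :=
      Finset.sum_nonneg fun i _ => Real.rpow_nonneg (hupos i x).le _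
    refine mul_le_mul_of_nonneg_right ?_ hsum
    rw [mul_assoc, ← mul_pow, ← mul_inv]
    refine mul_le_mul_of_nonneg_left ?_ hC.le
    calc (2 * R)⁻¹ ^ (2 * k) ≤ ‖x‖⁻¹ ^ (2 * k) := by gcongr
      _ = ‖x‖ ^ (-(2 * (k : ℝ))) := by
        rw [inv_pow, Real.rpow_neg (norm_nonneg x), ← Real.rpow_natCast]
        push_cast
        rfl
      _ ≤ ‖x‖ ^ (-σ) := Real.rpow_le_rpow_of_exponent_le hx1 (by linarith [hσ.2])
  intro x hx i j hj1 hjk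
  obtain ⟨K, hK⟩ := exists_integral_closedBall_le hn.le hupos hucont hus hp
    (show 0 < C * 2⁻¹ ^ (2 * k) by positivity) hlow i
  have hall : ∀ j, j ≤ k → 1 ≤ j → ∀ x, x ≠ 0 → 0 < negLapPow j (u i) x := by
    intro j hjk
    induction hjk using Nat.decreasingInduction with
    | self =>
      intro _ x hx
      rw [heq i x hx]
      exact mul_pos (Real.rpow_pos_of_pos (norm_pos_iff.2 hx) _) (hfpos i x)
    | of_succ j hj ih =>
      intro hj1 x hx
      exact negLapPow_pos_of_succ (by omega) (by omega) (hucont i) (hupos i)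
        ((hus i).of_le (by exact_mod_cast (by omega : 2 * (j + 1) ≤ 2 * k))) (ih (by omega)) hK hx
  exact hall j (by omega) hj1 x hx
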